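/- arXiv:0908.2179 — 5 statements merged into one kernel-verified Lean document; each statement's English description precedes it below -/
import Mathlib

section
/- Let K be any field and let n ≥ 2 and d ≥ 1 be integers. Then the Lie algebra [M_d(L_K(n))⁻, M_d(L_K(n))⁻] is a simple Lie algebra if and only if char(K) divides n−1 (i.e. (n−1)·1_K = 0 in K) and char(K) does not divide d (i.e. d·1_K ≠ 0 in K). -/
noncomputable section

open scoped BigOperators

attribute [local instance 100] LieRing.ofAssociativeRing

/-- The defining relations of the Cohn algebra `C_K(n)`: `y_i x_j = δ_{ij} 1`.
Generators of the free algebra: `Sum.inl i` is `x_i`, `Sum.inr i` is `y_i`.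
Quotienting by this relation is the same as quotienting by the two-sided ideal
generated by the elements `y_i x_j - δ_{ij} 1`. -/
inductive CohnRel (K : Type) [Field K] (n : ℕ) :
    FreeAlgebra K (Fin n ⊕ Fin n) → FreeAlgebra K (Fin n ⊕ Fin n) → Prop
  | rel (i j : Fin n) : CohnRel K n
      (FreeAlgebra.ι K (Sum.inr i) * FreeAlgebra.ι K (Sum.inl j))
      (if i = j then 1 else 0)

/-- The Cohn algebra `C_K(n)`. -/
abbrev CohnAlgebra (K : Type) [Field K] (n : ℕ) := RingQuot (CohnRel K n)

/-- The generator `x_i` of the Cohn algebra. -/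
def cX (K : Type) [Field K] (n : ℕ) (i : Fin n) : CohnAlgebra K n :=
  RingQuot.mkAlgHom K (CohnRel K n) (FreeAlgebra.ι K (Sum.inl i))

/-- The generator `y_i` of the Cohn algebra. -/
def cY (K : Type) [Field K] (n : ℕ) (i : Fin n) : CohnAlgebra K n :=
  RingQuot.mkAlgHom K (CohnRel K n) (FreeAlgebra.ι K (Sum.inr i))

/-- `x_I` for a word `I` in the alphabet `{1, …, n}` (words are lists, the empty
list being the empty word, with `x_φ = 1`). -/
def xw (K : Type) [Field K] (n : ℕ) (I : List (Fin n)) : CohnAlgebra K n :=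
  (I.map (cX K n)).prod

/-- `y_I` for a word `I`. -/
def yw (K : Type) [Field K] (n : ℕ) (I : List (Fin n)) : CohnAlgebra K n :=
  (I.map (cY K n)).prod

/-- The Leavitt relation `∑ x_i y_i = 1`; quotienting `C_K(n)` by this relation is
the same as quotienting by the two-sided ideal `M` generated by `1 - ∑ x_i y_i`. -/
inductive LeavittRel (K : Type) [Field K] (n : ℕ) :
    CohnAlgebra K n → CohnAlgebra K n → Prop
  | rel : LeavittRel K n (∑ i : Fin n, cX K n i * cY K n i) 1

/-- The Leavitt algebra `L_K(n) = C_K(n)/M`. -/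
abbrev LeavittAlgebra (K : Type) [Field K] (n : ℕ) := RingQuot (LeavittRel K n)

/-- The canonical quotient map `C_K(n) → L_K(n)`, `z ↦ z̄`. -/
def leavittQuot (K : Type) [Field K] (n : ℕ) : CohnAlgebra K n →ₐ[K] LeavittAlgebra K n :=
  RingQuot.mkAlgHom K (LeavittRel K n)

/-- A Leavitt family in a ring: `y_i x_j = δ_{ij}` and `∑ x_i y_i = 1`. -/
structure IsLeavittFamily {ι R : Type*} [Fintype ι] [DecidableEq ι] [Ring R] (X Y : ι → R) :
    Prop where
  mul_eq : ∀ i j, Y i * X j = if i = j then 1 else 0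
  sum_eq : ∑ i, X i * Y i = 1

lemma exists_ne_ne {ι : Type*} [Fintype ι] (hcard : 3 ≤ Fintype.card ι) (k l : ι) :
    ∃ m, m ≠ k ∧ m ≠ l := by
  classical
  obtain ⟨m, hm⟩ := Finset.exists_mem_notMem_of_card_lt_card
    (s := {k, l}) (t := (Finset.univ : Finset ι)) (by
      rw [Finset.card_univ]; exact lt_of_le_of_lt Finset.card_le_two hcard)
  exact ⟨m, by simpa using hm.2⟩

namespace IsLeavittFamily

variable {ι R : Type*} [Fintype ι] [DecidableEq ι] [Ring R] {X Y : ι → R}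

lemma mul_self (h : IsLeavittFamily X Y) (i : ι) : Y i * X i = 1 := by simp [h.mul_eq]

lemma mul_of_ne (h : IsLeavittFamily X Y) {i j : ι} (hij : i ≠ j) : Y i * X j = 0 := by
  simp [h.mul_eq, hij]

lemma unit_mul_unit (h : IsLeavittFamily X Y) (i j l : ι) (a b : R) :
    X i * a * Y j * (X j * b * Y l) = X i * (a * b) * Y l := by
  calc _ = X i * a * (Y j * X j) * b * Y l := by noncomm_ring
    _ = _ := by rw [h.mul_self]; noncomm_ring

lemma unit_mul_unit_of_ne (h : IsLeavittFamily X Y) (i : ι) {j k : ι} (l : ι) (a b : R)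
    (hjk : j ≠ k) : X i * a * Y j * (X k * b * Y l) = 0 := by
  calc _ = X i * a * (Y j * X k) * b * Y l := by noncomm_ring
    _ = _ := by rw [h.mul_of_ne hjk]; noncomm_ring

lemma unit_ne_zero (h : IsLeavittFamily X Y) (i j : ι) {a : R} (ha : a ≠ 0) :
    X i * a * Y j ≠ 0 := by
  intro h0
  apply ha
  calc a = (Y i * X i) * a * (Y j * X j) := by simp [h.mul_self]
    _ = Y i * (X i * a * Y j) * X j := by noncomm_ring
    _ = 0 := by simp [h0]

lemma eq_sum_unit (h : IsLeavittFamily X Y) (u : R) :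
    u = ∑ i, ∑ j, X i * (Y i * u * X j) * Y j := by
  calc u = (∑ i, X i * Y i) * u * (∑ j, X j * Y j) := by simp [h.sum_eq]
    _ = _ := by rw [Finset.sum_mul, Finset.sum_mul]; simp only [Finset.mul_sum, mul_assoc]

variable {U : AddSubgroup R}

/-- The off-diagonal position `(i, j)` can be moved to any other off-diagonal position. -/
lemma unit_mem_of_unit_mem (h : IsLeavittFamily X Y) (hcard : 3 ≤ Fintype.card ι)
    (hU : ∀ u ∈ U, ∀ i j, i ≠ j → ∀ r, X i * r * Y j * u - u * (X i * r * Y j) ∈ U)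
    {i j : ι} (hij : i ≠ j) {r : R} (hr : X i * r * Y j ∈ U) {k l : ι} (hkl : k ≠ l) :
    X k * r * Y l ∈ U := by
  have row {i j : ι} (hr : X i * r * Y j ∈ U) {k : ι} (hij : i ≠ j) (hkj : k ≠ j) :
      X k * r * Y j ∈ U := by
    obtain rfl | hki := eq_or_ne k i
    · exact hr
    · have := hU _ hr k i hki 1
      rwa [h.unit_mul_unit, h.unit_mul_unit_of_ne _ _ _ _ hkj.symm, one_mul, sub_zero] at this
  have col {i j : ι} (hr : X i * r * Y j ∈ U) {l : ι} (hij : i ≠ j) (hil : i ≠ l) :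
      X i * r * Y l ∈ U := by
    obtain rfl | hlj := eq_or_ne l j
    · exact hr
    · have := U.neg_mem (hU _ hr j l hlj.symm 1)
      rwa [h.unit_mul_unit, h.unit_mul_unit_of_ne _ _ _ _ hil.symm, mul_one, zero_sub,
        neg_neg] at this
  obtain ⟨m, hmj, hml⟩ := exists_ne_ne hcard j l
  exact row (col (row hr hij hmj) hmj hml) hml hkl

/-- A nonzero off-diagonal component forces all off-diagonal components. -/
lemma forall_unit_mem (h : IsLeavittFamily X Y) [IsSimpleRing R] (hcard : 3 ≤ Fintype.card ι)
    (hU : ∀ u ∈ U, ∀ i j, i ≠ j → ∀ r, X i * r * Y j * u - u * (X i * r * Y j) ∈ U)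
    {i j : ι} (hij : i ≠ j) {r : R} (hr0 : r ≠ 0) (hr : X i * r * Y j ∈ U) :
    ∀ k l, k ≠ l → ∀ s, X k * s * Y l ∈ U := by
  let I : TwoSidedIdeal R := TwoSidedIdeal.mk' {s | ∀ k l, k ≠ l → X k * s * Y l ∈ U}
    (by intro k l _; simp)
    (by intro x y hx hy k l hkl
        simpa [mul_add, add_mul] using U.add_mem (hx k l hkl) (hy k l hkl))
    (by intro x hx k l hkl
        simpa using U.neg_mem (hx k l hkl))
    (by intro x y hy k l hkl
        obtain ⟨m, hmk, hml⟩ := exists_ne_ne hcard k l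
        simpa [h.unit_mul_unit, h.unit_mul_unit_of_ne _ _ _ _ hkl.symm] using
          hU _ (hy m l hml) k m hmk.symm x)
    (by intro x y hx k l hkl
        obtain ⟨m, hmk, hml⟩ := exists_ne_ne hcard k l
        have := U.neg_mem (hU _ (hx k m hmk.symm) m l hml y)
        simpa [h.unit_mul_unit, h.unit_mul_unit_of_ne _ _ _ _ hkl.symm] using this)
  have hI : r ∈ I := by
    rw [TwoSidedIdeal.mem_mk']
    exact fun k l hkl => h.unit_mem_of_unit_mem hcard hU hij hr hkl
  have h1 := IsSimpleRing.one_mem_of_ne_zero_mem I hr0 hI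
  intro k l hkl s
  have hs : s ∈ I := by simpa using I.mul_mem_left s 1 h1
  rw [TwoSidedIdeal.mem_mk'] at hs
  exact hs k l hkl

/-- All commutators are sums of off-diagonal elements and brackets of these. -/
lemma commutator_mem (h : IsLeavittFamily X Y) [Nontrivial ι]
    (hU : ∀ u ∈ U, ∀ i j, i ≠ j → ∀ r, X i * r * Y j * u - u * (X i * r * Y j) ∈ U)
    (hoff : ∀ k l, k ≠ l → ∀ s, X k * s * Y l ∈ U) (a b : R) : a * b - b * a ∈ U := by
  have diag (i j : ι) (hij : i ≠ j) (p q : R) :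
      X i * (p * q) * Y i - X j * (q * p) * Y j ∈ U := by
    simpa [h.unit_mul_unit] using hU _ (hoff j i hij.symm q) i j hij p
  have key (i j k l : ι) (p q : R) :
      X i * p * Y j * (X k * q * Y l) - X k * q * Y l * (X i * p * Y j) ∈ U := by
    by_cases hjk : j = k <;> by_cases hli : l = i
    · subst hjk hli
      rw [h.unit_mul_unit, h.unit_mul_unit]
      by_cases hlj : l = j
      · subst hlj
        obtain ⟨m, hm⟩ := exists_ne l
        simpa using U.sub_mem (diag l m hm.symm p q) (diag l m hm.symm (q * p) 1)
      · exact diag l j hlj p q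
    · subst hjk
      rw [h.unit_mul_unit, h.unit_mul_unit_of_ne _ _ _ _ hli, sub_zero]
      exact hoff _ _ (Ne.symm hli) _
    · subst hli
      rw [h.unit_mul_unit, h.unit_mul_unit_of_ne _ _ _ _ hjk, zero_sub]
      exact U.neg_mem (hoff _ _ (Ne.symm hjk) _)
    · rw [h.unit_mul_unit_of_ne _ _ _ _ hjk, h.unit_mul_unit_of_ne _ _ _ _ hli, sub_zero]
      exact U.zero_mem
  have sum_left (f : ι → R) (c : R) (H : ∀ k, f k * c - c * f k ∈ U) :
      (∑ k, f k) * c - c * ∑ k, f k ∈ U := by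
    rw [Finset.sum_mul, Finset.mul_sum, ← Finset.sum_sub_distrib]
    exact U.sum_mem fun k _ => H k
  have sum_right (f : ι → R) (c : R) (H : ∀ k, c * f k - f k * c ∈ U) :
      c * (∑ k, f k) - (∑ k, f k) * c ∈ U := by
    rw [Finset.sum_mul, Finset.mul_sum, ← Finset.sum_sub_distrib]
    exact U.sum_mem fun k _ => H k
  rw [h.eq_sum_unit a, h.eq_sum_unit b]
  exact sum_left _ _ fun i => sum_left _ _ fun j => sum_right _ _ fun k => sum_right _ _ fun l =>
    key i j k l _ _

/-- An additive subgroup stable under bracketing with off-diagonal elements is central or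
contains all off-diagonal elements. -/
lemma mem_center_or_forall_unit_mem (h : IsLeavittFamily X Y) [IsSimpleRing R]
    (hcard : 3 ≤ Fintype.card ι)
    (hU : ∀ u ∈ U, ∀ i j, i ≠ j → ∀ r, X i * r * Y j * u - u * (X i * r * Y j) ∈ U)
    {u : R} (hu : u ∈ U) :
    u ∈ Subring.center R ∨ ∀ k l, k ≠ l → ∀ s, X k * s * Y l ∈ U := by
  by_cases hoff : ∃ i j, i ≠ j ∧ Y i * u * X j ≠ 0
  · obtain ⟨i, j, hij, hne⟩ := hoff
    obtain ⟨k, hki, hkj⟩ := exists_ne_ne hcard i j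
    right
    refine h.forall_unit_mem hcard hU hij.symm hne (U.neg_mem_iff.mp ?_)
    have := hU _ (hU _ (hU _ hu j i hij.symm 1) k i hki 1) j k hkj.symm 1
    convert this using 1
    have hkk (z : R) : Y k * (X k * z) = z := by rw [← mul_assoc, h.mul_self, one_mul]
    have hzero {p q : ι} (hpq : p ≠ q) (z : R) : Y p * (X q * z) = 0 := by
      rw [← mul_assoc, h.mul_of_ne hpq, zero_mul]
    simp [mul_sub, sub_mul, mul_assoc, hkk, hzero hij, hzero hki.symm, hzero hkj]
  · push Not at hoff
    have hdiag : u = ∑ i, X i * (Y i * u * X i) * Y i := by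
      conv_lhs => rw [h.eq_sum_unit u]
      refine Finset.sum_congr rfl fun i _ => Finset.sum_eq_single i (fun j _ hj => ?_) (by simp)
      rw [hoff i j hj.symm, mul_zero, zero_mul]
    have hYu (i : ι) : Y i * u = Y i * u * X i * Y i := by
      conv_lhs => rw [← mul_one (Y i * u), ← h.sum_eq, Finset.mul_sum]
      rw [Finset.sum_eq_single i (fun j _ hj => ?_) (by simp), mul_assoc (Y i * u)]
      rw [← mul_assoc, hoff i j hj.symm, zero_mul]
    have huX (i : ι) : u * X i = X i * (Y i * u * X i) := by
      conv_lhs => rw [← one_mul (u * X i), ← h.sum_eq, Finset.sum_mul]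
      rw [Finset.sum_eq_single i (fun j _ hj => ?_) (by simp)]
      · simp only [mul_assoc]
      · rw [mul_assoc, ← mul_assoc (Y j), hoff j i hj, mul_zero]
    by_cases hcomm : ∃ i j r, i ≠ j ∧ r * (Y j * u * X j) - (Y i * u * X i) * r ≠ 0
    · obtain ⟨i, j, r, hij, hne⟩ := hcomm
      right
      refine h.forall_unit_mem hcard hU hij hne ?_
      have := hU _ hu i j hij r
      convert this using 1
      calc _ = X i * r * (Y j * u * X j * Y j) - X i * (Y i * u * X i) * r * Y j := by
            noncomm_ring
        _ = _ := by rw [← hYu, ← huX]; noncomm_ring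
    · push Not at hcomm
      left
      have hcard' : 1 < Fintype.card ι := by omega
      have : Nontrivial ι := Fintype.one_lt_card_iff_nontrivial.mp hcard'
      have hconst (i j : ι) : Y j * u * X j = Y i * u * X i := by
        obtain rfl | hij := eq_or_ne i j
        · rfl
        · simpa [sub_eq_zero] using hcomm i j 1 hij
      obtain ⟨i, j, hij⟩ := exists_pair_ne ι
      have hcen (r : R) : r * (Y i * u * X i) = Y i * u * X i * r := by
        simpa [sub_eq_zero, hconst i j] using hcomm i j r hij
      have hu' : u = Y i * u * X i := by
        conv_lhs => rw [hdiag]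
        simp_rw [hconst i, hcen, mul_assoc (Y i * u * X i), ← Finset.mul_sum, h.sum_eq, mul_one]
      rw [Subring.mem_center_iff]
      intro g
      rw [hu', hcen]

end IsLeavittFamily

section Lie

variable {K R : Type*} [Field K] [Ring R] [Algebra K R]

lemma derivedSeries_one_toSubmodule_eq_span :
    (LieAlgebra.derivedSeries K R 1).toSubmodule =
      Submodule.span K {⁅x, y⁆ | (x : R) (y : R)} :=
  LieAlgebra.coe_derivedSeries_one_eq K R

lemma commutator_mem_derivedSeries_one (a b : R) :
    a * b - b * a ∈ LieAlgebra.derivedSeries K R 1 := by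
  rw [← LieSubmodule.mem_toSubmodule, derivedSeries_one_toSubmodule_eq_span]
  exact Submodule.subset_span ⟨a, b, rfl⟩

lemma derivedSeries_one_toSubmodule_le {P : Submodule K R} (hP : ∀ a b, a * b - b * a ∈ P) :
    (LieAlgebra.derivedSeries K R 1).toSubmodule ≤ P := by
  rw [derivedSeries_one_toSubmodule_eq_span, Submodule.span_le]
  rintro _ ⟨a, b, rfl⟩
  exact hP a b

/-- If a nonzero central element of a simple ring is a sum of commutators, so is `1`. -/
lemma one_mem_derivedSeries_one_of_mem_center [IsSimpleRing R] {u : R} (hu0 : u ≠ 0)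
    (hu : u ∈ Subring.center R) (hmem : u ∈ LieAlgebra.derivedSeries K R 1) :
    (1 : R) ∈ LieAlgebra.derivedSeries K R 1 := by
  obtain ⟨v, hv⟩ := (IsSimpleRing.isField_center R).mul_inv_cancel
    (a := (⟨u, hu⟩ : Subring.center R)) (by simpa [Subtype.ext_iff] using hu0)
  have hv' : u * v = 1 := congrArg Subtype.val hv
  have hvc := Subring.mem_center_iff.mp v.2
  have := derivedSeries_one_toSubmodule_le
    (P := (LieAlgebra.derivedSeries K R 1).toSubmodule.comap
      (LinearMap.mulRight K (v : R))) (fun a b => by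
        simp only [Submodule.mem_comap, LinearMap.mulRight_apply, LieSubmodule.mem_toSubmodule]
        have := commutator_mem_derivedSeries_one (K := K) a (b * v)
        rwa [show a * (b * v) - b * v * a = (a * b - b * a) * v by
          rw [mul_assoc b, ← hvc a]; noncomm_ring] at this) hmem
  simpa [hv'] using this

/-- If `1` is a sum of commutators then `[R, R]` contains the central ideal `K 1` and hence is
not simple. -/
lemma not_isSimple_of_one_mem (h1 : (1 : R) ∈ LieAlgebra.derivedSeries K R 1) :
    ¬ LieAlgebra.IsSimple K (LieAlgebra.derivedSeries K R 1) := by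
  intro hs
  have hcen (c : K) (z : R) : ⁅z, c • (1 : R)⁆ = 0 := by
    simp [LieRing.of_associative_ring_bracket]
  let I : LieIdeal K (LieAlgebra.derivedSeries K R 1) :=
    { Submodule.span K {(⟨1, h1⟩ : LieAlgebra.derivedSeries K R 1)} with
      lie_mem := by
        intro x m hm
        obtain ⟨c, rfl⟩ := Submodule.mem_span_singleton.mp hm
        have : ⁅x, c • (⟨1, h1⟩ : LieAlgebra.derivedSeries K R 1)⁆ = 0 :=
          Subtype.ext (hcen c x)
        rw [this]
        exact Submodule.zero_mem _ }
  apply hs.non_abelian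
  have h1I : (⟨1, h1⟩ : LieAlgebra.derivedSeries K R 1) ∈ I := Submodule.mem_span_singleton_self _
  obtain hI | hI := hs.eq_bot_or_eq_top I
  · rw [hI, LieSubmodule.mem_bot] at h1I
    have h10 : (1 : R) = 0 := congrArg Subtype.val h1I
    have := subsingleton_of_zero_eq_one h10.symm
    exact ⟨fun x y => Subtype.ext (Subsingleton.elim _ _)⟩
  · refine ⟨fun x y => ?_⟩
    have hy : y ∈ I := hI ▸ LieSubmodule.mem_top y
    obtain ⟨c, rfl⟩ := Submodule.mem_span_singleton.mp hy
    exact Subtype.ext (hcen c x)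

/-- The derived Lie algebra of a simple ring with a Leavitt family of size at least three is
simple as soon as `1` is not a sum of commutators. -/
theorem IsLeavittFamily.isSimple_derivedSeries_one {ι : Type*} [Fintype ι] [DecidableEq ι]
    {X Y : ι → R} (h : IsLeavittFamily X Y) [IsSimpleRing R] (hcard : 3 ≤ Fintype.card ι)
    (h1 : (1 : R) ∉ LieAlgebra.derivedSeries K R 1) :
    LieAlgebra.IsSimple K (LieAlgebra.derivedSeries K R 1) := by
  have : Nontrivial ι := Fintype.one_lt_card_iff_nontrivial.mp (by omega)
  have hoff (i j : ι) (hij : i ≠ j) (r : R) :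
      X i * r * Y j ∈ LieAlgebra.derivedSeries K R 1 := by
    have := commutator_mem_derivedSeries_one (K := K) (X i * r * Y i) (X i * 1 * Y j)
    rwa [h.unit_mul_unit, h.unit_mul_unit_of_ne _ _ _ _ hij.symm, sub_zero, mul_one] at this
  refine ⟨fun I => ?_, fun hab => ?_⟩
  · refine or_iff_not_imp_left.mpr fun hI => ?_
    rw [LieSubmodule.eq_bot_iff] at hI
    push Not at hI
    obtain ⟨u, huI, hu0⟩ := hI
    let U : AddSubgroup R :=
      (I.toSubmodule.map (LieAlgebra.derivedSeries K R 1).toSubmodule.subtype).toAddSubgroup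
    have memU (v : LieAlgebra.derivedSeries K R 1) : (v : R) ∈ U ↔ v ∈ I := by
      constructor
      · rintro ⟨w, hw, hwv⟩
        rwa [← Subtype.ext hwv]
      · exact fun hv => ⟨v, hv, rfl⟩
    have hU : ∀ u ∈ U, ∀ i j, i ≠ j → ∀ r, X i * r * Y j * u - u * (X i * r * Y j) ∈ U := by
      rintro _ ⟨v, hv, rfl⟩ i j hij r
      exact ⟨⁅⟨_, hoff i j hij r⟩, v⁆, LieSubmodule.lie_mem I hv, rfl⟩
    obtain hc | hall := h.mem_center_or_forall_unit_mem hcard hU ((memU u).mpr huI)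
    · exact absurd (one_mem_derivedSeries_one_of_mem_center
        (fun h0 => hu0 (Subtype.ext h0)) hc u.2) h1
    · rw [eq_top_iff]
      intro v _
      refine (memU v).mp (derivedSeries_one_toSubmodule_le
        (P := I.toSubmodule.map (LieAlgebra.derivedSeries K R 1).toSubmodule.subtype)
        (fun a b => h.commutator_mem hU hall a b) v.2)
  · obtain ⟨i, j, hij⟩ := exists_pair_ne ι
    obtain ⟨k, hki, hkj⟩ := exists_ne_ne hcard i j
    have := congrArg Subtype.val (hab.trivial
      (⟨_, hoff i k hki.symm 1⟩ : LieAlgebra.derivedSeries K R 1) ⟨_, hoff k j hkj 1⟩)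
    change X i * 1 * Y k * (X k * 1 * Y j) - X k * 1 * Y j * (X i * 1 * Y k) = 0 at this
    rw [h.unit_mul_unit, h.unit_mul_unit_of_ne _ _ _ _ hij.symm, sub_zero] at this
    exact h.unit_ne_zero i j (by simp) this

end Lie

namespace IsLeavittFamily

variable {ι K A : Type*} [Field K] [Ring A] [Algebra K A] {X Y : ι → A}

/-- The span of the products `x_I` with `I` a word of length at least `m`. -/
def longWords (K : Type*) [Field K] [Algebra K A] (X : ι → A) (m : ℕ) : Submodule K A :=
  Submodule.span K {p | ∃ I : List ι, m ≤ I.length ∧ p = (I.map X).prod}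

lemma prod_mem_longWords {m : ℕ} {I : List ι} (hI : m ≤ I.length) :
    (I.map X).prod ∈ longWords K X m :=
  Submodule.subset_span ⟨I, hI, rfl⟩

lemma longWords_anti {m m' : ℕ} (hm : m ≤ m') : longWords K X m' ≤ longWords K X m :=
  Submodule.span_mono fun _ ⟨I, hI, hp⟩ => ⟨I, hm.trans hI, hp⟩

/-- The word `0^m 1` separates words `I`, `J` with `|I| ≤ |J| ≤ m`. -/
lemma eq_of_append_prefix_append {i₀ i₁ : ι} (hne : i₀ ≠ i₁) {m : ℕ} {I J : List ι}
    (hIJ : I.length ≤ J.length) (hJ : J.length ≤ m)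
    (hpre : I ++ (List.replicate m i₀ ++ [i₁]) <+: J ++ (List.replicate m i₀ ++ [i₁])) :
    I = J := by
  have hget := hpre.getElem (i := I.length + m) (by simp)
  have hlen : I.length = J.length := by
    by_contra hlt
    apply hne
    rw [List.getElem_append_right (by omega), List.getElem_append_right (by simp),
      List.getElem_append_right (by omega),
      List.getElem_append_left (by simp; omega)] at hget
    simpa using hget.symm
  exact List.prefix_iff_eq_take.mp (List.prefix_of_prefix_length_le
    ((List.prefix_append _ _).trans hpre) (List.prefix_append _ _) hIJ) |>.trans
      (by rw [hlen, List.take_length])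

variable [Fintype ι] [DecidableEq ι]

/-- Left multiplication by `a` shortens words by a bounded amount. -/
lemma exists_mul_mem_longWords (h : IsLeavittFamily X Y)
    (hgen : Algebra.adjoin K (Set.range X ∪ Set.range Y) = ⊤) (a : A) :
    ∃ k, ∀ m, ∀ p ∈ longWords K X (k + m), a * p ∈ longWords K X m := by
  have ha : a ∈ Algebra.adjoin K (Set.range X ∪ Set.range Y) := hgen ▸ Algebra.mem_top
  have of_words (b : A) (k : ℕ)
      (hb : ∀ m, ∀ I : List ι, k + m ≤ I.length → b * (I.map X).prod ∈ longWords K X m) :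
      ∀ m, ∀ p ∈ longWords K X (k + m), b * p ∈ longWords K X m := by
    intro m p hp
    have : longWords K X (k + m) ≤ (longWords K X m).comap (LinearMap.mulLeft K b) := by
      rw [longWords, Submodule.span_le]
      rintro _ ⟨I, hI, rfl⟩
      exact hb m I hI
    exact this hp
  induction ha using Algebra.adjoin_induction with
  | mem x hx =>
    obtain ⟨i, rfl⟩ | ⟨i, rfl⟩ := hx
    · refine ⟨0, of_words _ _ fun m I hI => ?_⟩
      have := prod_mem_longWords (K := K) (X := X) (m := m) (I := i :: I) (by simp; omega)
      simpa using this
    · refine ⟨1, of_words _ _ fun m I hI => ?_⟩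
      cases I with
      | nil => simp at hI
      | cons j I =>
        rw [List.map_cons, List.prod_cons, ← mul_assoc, h.mul_eq]
        split_ifs
        · rw [one_mul]
          exact prod_mem_longWords (by simp at hI; omega)
        · simp
  | algebraMap r =>
    refine ⟨0, fun m p hp => ?_⟩
    rw [← Algebra.smul_def]
    exact Submodule.smul_mem _ _ (by simpa using hp)
  | add x y _ _ hx hy =>
    obtain ⟨k, hk⟩ := hx
    obtain ⟨l, hl⟩ := hy
    refine ⟨k + l, fun m p hp => ?_⟩
    rw [add_mul]
    exact Submodule.add_mem _ (hk m p (longWords_anti (by omega) hp))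
      (hl m p (longWords_anti (by omega) hp))
  | mul x y _ _ hx hy =>
    obtain ⟨k, hk⟩ := hx
    obtain ⟨l, hl⟩ := hy
    refine ⟨l + k, fun m p hp => ?_⟩
    rw [mul_assoc]
    exact hk m _ (hl (k + m) p (by rwa [← add_assoc]))

lemma exists_mul_prod_ne_zero (h : IsLeavittFamily X Y) {a : A} (ha : a ≠ 0) (N : ℕ) :
    ∃ I : List ι, I.length = N ∧ a * (I.map X).prod ≠ 0 := by
  induction N generalizing a with
  | zero => exact ⟨[], rfl, by simpa using ha⟩
  | succ N ih =>
    obtain ⟨i, hi⟩ : ∃ i, a * X i ≠ 0 := by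
      by_contra! hc
      apply ha
      rw [← mul_one a, ← h.sum_eq, Finset.mul_sum]
      exact Finset.sum_eq_zero fun i _ => by rw [← mul_assoc, hc, zero_mul]
    obtain ⟨I, hI, hne⟩ := ih hi
    exact ⟨i :: I, by simp [hI], by simpa [mul_assoc] using hne⟩

lemma prod_reverse_mul_prod_self (h : IsLeavittFamily X Y) (I : List ι) :
    (I.map Y).reverse.prod * (I.map X).prod = 1 := by
  induction I with
  | nil => simp
  | cons i I ih =>
    calc _ = (I.map Y).reverse.prod * (Y i * X i) * (I.map X).prod := by simp [mul_assoc]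
      _ = 1 := by rw [h.mul_self, mul_one, ih]

lemma prod_reverse_mul_prod_eq_zero (h : IsLeavittFamily X Y) {I J : List ι}
    (hlen : I.length ≤ J.length) (hIJ : ¬ I <+: J) :
    (I.map Y).reverse.prod * (J.map X).prod = 0 := by
  induction I generalizing J with
  | nil => simp at hIJ
  | cons i I ih =>
    cases J with
    | nil => simp at hlen
    | cons j J =>
      calc _ = (I.map Y).reverse.prod * (Y i * X j) * (J.map X).prod := by simp [mul_assoc]
        _ = 0 := by
          rw [h.mul_eq]
          split_ifs with hij
          · subst hij
            rw [mul_one]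
            exact ih (by simpa using hlen) (by simpa [List.cons_prefix_cons] using hIJ)
          · simp

/-- An algebra generated by a Leavitt family of size at least two is simple. -/
theorem isSimpleRing (h : IsLeavittFamily X Y) [Nontrivial ι] [Nontrivial A]
    (hgen : Algebra.adjoin K (Set.range X ∪ Set.range Y) = ⊤) : IsSimpleRing A := by
  refine ⟨⟨fun I => or_iff_not_imp_left.mpr fun hI => ?_⟩⟩
  obtain ⟨a, haI, ha0⟩ : ∃ a ∈ I, a ≠ 0 := by
    by_contra! hc
    exact hI (le_antisymm (fun x hx => by simpa using hc x hx) bot_le)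
  obtain ⟨k, hk⟩ := h.exists_mul_mem_longWords hgen a
  obtain ⟨W, hW, hWne⟩ := h.exists_mul_prod_ne_zero ha0 k
  have hspan := hk 0 _ (prod_mem_longWords (K := K) (X := X) (I := W) (by omega))
  have hpI : a * (W.map X).prod ∈ I := I.mul_mem_right _ _ haI
  generalize a * (W.map X).prod = p at *
  have hset : {p | ∃ I : List ι, 0 ≤ I.length ∧ p = (I.map X).prod} =
      Set.range fun I : List ι => (I.map X).prod := by
    ext q
    simp [eq_comm]
  rw [longWords, hset, Finsupp.mem_span_range_iff_exists_finsupp] at hspan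
  obtain ⟨c, rfl⟩ := hspan
  have hc : c.support.Nonempty := by
    rw [Finsupp.support_nonempty_iff]
    rintro rfl
    simp at hWne
  obtain ⟨J, hJ, hmin⟩ := c.support.exists_min_image List.length hc
  obtain ⟨i₀, i₁, hne⟩ := exists_pair_ne ι
  set m := c.support.sup List.length
  set u := List.replicate m i₀ ++ [i₁]
  have key : ((J ++ u).map Y).reverse.prod * (c.sum fun L r => r • (L.map X).prod) *
      (u.map X).prod = algebraMap K A (c J) := by
    rw [Finsupp.sum, Finset.mul_sum, Finset.sum_mul, Finset.sum_eq_single J]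
    · rw [mul_smul_comm, smul_mul_assoc, mul_assoc, ← List.prod_append, ← List.map_append,
        h.prod_reverse_mul_prod_self, Algebra.algebraMap_eq_smul_one]
    · intro L hL hLJ
      rw [mul_smul_comm, smul_mul_assoc, mul_assoc, ← List.prod_append, ← List.map_append,
        h.prod_reverse_mul_prod_eq_zero, smul_zero]
      · simpa using hmin L hL
      · exact fun hpre => hLJ
          (eq_of_append_prefix_append hne (hmin L hL) (Finset.le_sup hL) hpre).symm
    · exact fun hJ' => absurd hJ hJ'
  have hmem := I.mul_mem_right _ (u.map X).prod
    (I.mul_mem_left ((J ++ u).map Y).reverse.prod _ hpI)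
  rw [key] at hmem
  have h1 : (1 : A) ∈ I := by
    have := I.mul_mem_left (algebraMap K A (c J)⁻¹) _ hmem
    rwa [← map_mul, inv_mul_cancel₀ (Finsupp.mem_support_iff.mp hJ), map_one] at this
  exact eq_top_iff.mpr fun x _ => by simpa using I.mul_mem_left x 1 h1

end IsLeavittFamily

section Trace

variable (K : Type) [Field K] (n : ℕ)

/-- The operator prefixing words by `i`, on functions on words. -/
def fockX (i : Fin n) : Module.End K (List (Fin n) → K) where
  toFun f
    | [] => 0
    | j :: v => if j = i then f v else 0
  map_add' f g := by
    ext w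
    cases w <;> simp [ite_add_ite]
  map_smul' c f := by
    ext w
    cases w <;> simp

/-- The operator removing the first letter `i`, on functions on words. -/
def fockY (i : Fin n) : Module.End K (List (Fin n) → K) where
  toFun f v := f (i :: v)
  map_add' _ _ := rfl
  map_smul' _ _ := rfl

/-- The operator appending the letter `i`, on functions on words. -/
def fockAppend (i : Fin n) : Module.End K (List (Fin n) → K) where
  toFun f w := if w.getLast? = some i then f w.dropLast else 0
  map_add' f g := by
    ext w
    simp [ite_add_ite]
  map_smul' c f := by
    ext w
    simp

/-- Functions supported on words of length at least `m`. -/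
def longFunctions (m : ℕ) : Submodule K (List (Fin n) → K) where
  carrier := {f | ∀ w, w.length < m → f w = 0}
  zero_mem' _ _ := rfl
  add_mem' hf hg w hw := by simp [hf w hw, hg w hw]
  smul_mem' c f hf w hw := by simp [hf w hw]

/-- The Fock representation of the Cohn algebra. -/
def fockRep : CohnAlgebra K n →ₐ[K] Module.End K (List (Fin n) → K) :=
  RingQuot.liftAlgHom K ⟨FreeAlgebra.lift K (Sum.elim (fockX K n) (fockY K n)), by
    rintro _ _ ⟨i, j⟩
    ext f w
    by_cases hij : i = j <;> simp [fockX, fockY, hij]⟩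

/-- Summation of a function over all words of length `N`. -/
def wordSum : ℕ → ((List (Fin n) → K) →ₗ[K] K)
  | 0 => LinearMap.proj []
  | N + 1 => ∑ i, wordSum N ∘ₗ fockY K n i

/-- The sum of the diagonal coefficients of an operator over all words of length `N`. -/
def partialTrace (N : ℕ) : CohnAlgebra K n →ₗ[K] K :=
  wordSum K n N ∘ₗ
    { toFun a w := fockRep K n a (Pi.single w 1) w
      map_add' a b := by ext; simp
      map_smul' c a := by ext; simp }

variable {K n}

lemma fockRep_cX (i : Fin n) : fockRep K n (cX K n i) = fockX K n i := by
  simp [fockRep, cX]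

lemma fockRep_cY (i : Fin n) : fockRep K n (cY K n i) = fockY K n i := by
  simp [fockRep, cY]

lemma cohn_induction {P : CohnAlgebra K n → Prop} (halg : ∀ r, P (algebraMap K _ r))
    (hX : ∀ i, P (cX K n i)) (hY : ∀ i, P (cY K n i))
    (hadd : ∀ a b, P a → P b → P (a + b)) (hmul : ∀ a b, P a → P b → P (a * b))
    (a : CohnAlgebra K n) : P a := by
  obtain ⟨f, rfl⟩ := RingQuot.mkAlgHom_surjective K (CohnRel K n) a
  induction f with
  | grade0 r => simpa using halg r
  | grade1 x => exact x.casesOn hX hY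
  | mul a b ha hb => rw [map_mul]; exact hmul _ _ ha hb
  | add a b ha hb => rw [map_add]; exact hadd _ _ ha hb

lemma longFunctions_anti {m m' : ℕ} (hm : m ≤ m') : longFunctions K n m' ≤ longFunctions K n m :=
  fun _ hf w hw => hf w (hw.trans_le hm)

lemma fockX_single (i : Fin n) (w : List (Fin n)) :
    fockX K n i (Pi.single w 1) = Pi.single (i :: w) 1 := by
  ext v
  cases v with
  | nil => simp [fockX]
  | cons j v => by_cases hj : j = i <;> simp [fockX, Pi.single_apply, hj]

lemma fockY_single (i j : Fin n) (w : List (Fin n)) :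
    fockY K n i (Pi.single (j :: w) 1) = if i = j then Pi.single w 1 else 0 := by
  ext v
  by_cases hj : i = j <;> simp [fockY, Pi.single_apply, hj]

lemma fockAppend_single (i : Fin n) (w : List (Fin n)) :
    fockAppend K n i (Pi.single w 1) = Pi.single (w ++ [i]) 1 := by
  ext v
  induction v using List.reverseRecOn with
  | nil => simp [fockAppend]
  | append_singleton v j =>
    by_cases hj : j = i <;> simp [fockAppend, Pi.single_apply, hj]

lemma fockX_fockAppend (i j : Fin n) (f : List (Fin n) → K) :
    fockX K n i (fockAppend K n j f) = fockAppend K n j (fockX K n i f) := by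
  ext w
  match w with
  | [] => simp [fockX, fockAppend]
  | [k] => simp [fockX, fockAppend]
  | k :: l :: v =>
    by_cases hk : k = i <;> simp [fockX, fockAppend, hk]

lemma fockY_fockAppend (i j : Fin n) {f : List (Fin n) → K} (hf : f ∈ longFunctions K n 1) :
    fockY K n i (fockAppend K n j f) = fockAppend K n j (fockY K n i f) := by
  ext w
  match w with
  | [] => simp [fockY, fockAppend, hf [] (by simp)]
  | k :: v => simp [fockY, fockAppend]

/-- On long words, elements of the Cohn algebra act only on the beginning of the word. -/
lemma exists_fockRep_append (a : CohnAlgebra K n) :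
    ∃ k, ∀ m, ∀ f ∈ longFunctions K n (k + m), fockRep K n a f ∈ longFunctions K n m ∧
      ∀ i, fockRep K n a (fockAppend K n i f) = fockAppend K n i (fockRep K n a f) := by
  induction a using cohn_induction with
  | halg r =>
    refine ⟨0, fun m f hf => ⟨?_, fun i => ?_⟩⟩
    · simpa [Algebra.algebraMap_eq_smul_one] using
        Submodule.smul_mem _ r (longFunctions_anti (by omega) hf)
    · simp [Algebra.algebraMap_eq_smul_one]
  | hX i =>
    refine ⟨0, fun m f hf => ⟨fun w hw => ?_, fun j => ?_⟩⟩
    · rw [fockRep_cX]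
      cases w with
      | nil => simp [fockX]
      | cons k v => simp [fockX, hf v (by simp at hw; omega)]
    · rw [fockRep_cX, fockX_fockAppend]
  | hY i =>
    refine ⟨1, fun m f hf => ⟨fun w hw => ?_, fun j => ?_⟩⟩
    · rw [fockRep_cY]
      exact hf (i :: w) (by simp; omega)
    · rw [fockRep_cY, fockY_fockAppend _ _ (longFunctions_anti (by omega) hf)]
  | hadd a b ha hb =>
    obtain ⟨k, hk⟩ := ha
    obtain ⟨l, hl⟩ := hb
    refine ⟨k + l, fun m f hf => ?_⟩
    obtain ⟨h1, h2⟩ := hk m f (longFunctions_anti (by omega) hf)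
    obtain ⟨h3, h4⟩ := hl m f (longFunctions_anti (by omega) hf)
    exact ⟨by simpa using Submodule.add_mem _ h1 h3, fun i => by simp [h2, h4]⟩
  | hmul a b ha hb =>
    obtain ⟨k, hk⟩ := ha
    obtain ⟨l, hl⟩ := hb
    refine ⟨l + k, fun m f hf => ?_⟩
    obtain ⟨h3, h4⟩ := hl (k + m) f (longFunctions_anti (by omega) hf)
    obtain ⟨h1, h2⟩ := hk m _ h3
    exact ⟨by simpa using h1, fun i => by simp [h2, h4]⟩

lemma wordSum_congr {N : ℕ} {f g : List (Fin n) → K} (h : ∀ w, w.length = N → f w = g w) :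
    wordSum K n N f = wordSum K n N g := by
  induction N generalizing f g with
  | zero => exact h [] rfl
  | succ N ih =>
    simp only [wordSum, LinearMap.sum_apply, LinearMap.comp_apply]
    exact Finset.sum_congr rfl fun i _ => ih fun w hw => h (i :: w) (by simp [hw])

lemma wordSum_succ_last (N : ℕ) (f : List (Fin n) → K) :
    wordSum K n (N + 1) f = ∑ i, wordSum K n N fun w => f (w ++ [i]) := by
  induction N generalizing f with
  | zero => simp [wordSum, fockY]
  | succ N ih =>
    have hsucc (M : ℕ) (g : List (Fin n) → K) :
        wordSum K n (M + 1) g = ∑ i, wordSum K n M (fockY K n i g) := by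
      simp [wordSum]
    rw [hsucc, Finset.sum_congr rfl fun i _ => ih (fockY K n i f), Finset.sum_comm]
    exact Finset.sum_congr rfl fun i _ => (hsucc N fun w => f (w ++ [i])).symm

lemma partialTrace_cX_mul (i : Fin n) (b : CohnAlgebra K n) (N : ℕ) :
    partialTrace K n (N + 1) (cX K n i * b) = partialTrace K n N (b * cX K n i) := by
  simp only [partialTrace, LinearMap.comp_apply, wordSum, LinearMap.sum_apply]
  rw [Finset.sum_eq_single i]
  · congr 1
    ext w
    simp [fockY, fockRep_cX, fockX_single]
    simp [fockX]
  · intro j _ hj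
    convert map_zero (wordSum K n N)
    ext w
    simp [fockY, fockRep_cX]
    simp [fockX, hj]
  · simp

lemma partialTrace_cY_mul (i : Fin n) (b : CohnAlgebra K n) (N : ℕ) :
    partialTrace K n N (cY K n i * b) = partialTrace K n (N + 1) (b * cY K n i) := by
  simp only [partialTrace, LinearMap.comp_apply, wordSum, LinearMap.sum_apply]
  rw [Finset.sum_eq_single i]
  · congr 1
    ext w
    change fockRep K n (cY K n i * b) (Pi.single w 1) w =
      fockRep K n (b * cY K n i) (Pi.single (i :: w) 1) (i :: w)
    rw [map_mul, map_mul, fockRep_cY, Module.End.mul_apply, Module.End.mul_apply, fockY_single,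
      if_pos rfl]
    rfl
  · intro j _ hj
    convert map_zero (wordSum K n N)
    ext w
    change fockRep K n (b * cY K n i) (Pi.single (j :: w) 1) (j :: w) = 0
    rw [map_mul, fockRep_cY, Module.End.mul_apply, fockY_single, if_neg hj.symm]
    simp
  · simp

lemma single_mem_longFunctions (w : List (Fin n)) :
    (Pi.single w 1 : List (Fin n) → K) ∈ longFunctions K n w.length := by
  intro v hv
  rw [Pi.single_apply, if_neg]
  rintro rfl
  exact hv.false

lemma partialTrace_succ_eventually (hn : (n : K) = 1) (a : CohnAlgebra K n) :
    ∃ k, ∀ N ≥ k, partialTrace K n (N + 1) a = partialTrace K n N a := by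
  obtain ⟨k, hk⟩ := exists_fockRep_append a
  refine ⟨k, fun N hN => ?_⟩
  rw [partialTrace, LinearMap.comp_apply, wordSum_succ_last, partialTrace, LinearMap.comp_apply]
  trans ∑ _i : Fin n, wordSum K n N fun w => fockRep K n a (Pi.single w 1) w
  · refine Finset.sum_congr rfl fun i _ => wordSum_congr fun w hw => ?_
    change fockRep K n a (Pi.single (w ++ [i]) 1) (w ++ [i]) = _
    rw [← fockAppend_single, (hk (N - k) _ (longFunctions_anti (by omega)
      (single_mem_longFunctions w))).2]
    simp [fockAppend]
  · simp [hn]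

lemma partialTrace_one (hn : (n : K) = 1) (N : ℕ) : partialTrace K n N 1 = 1 := by
  rw [partialTrace, LinearMap.comp_apply]
  trans wordSum K n N fun _ => 1
  · exact wordSum_congr fun w _ => by simp
  · induction N with
    | zero => simp [wordSum]
    | succ N ih =>
      rw [wordSum_succ_last]
      simp [ih, hn]

lemma partialTrace_mul_sum (a : CohnAlgebra K n) {N : ℕ} (hN : 1 ≤ N) :
    partialTrace K n N (a * ∑ i, cX K n i * cY K n i) = partialTrace K n N a := by
  refine wordSum_congr fun w hw => ?_
  cases w with
  | nil => simp at hw; omega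
  | cons j w =>
    change fockRep K n _ _ _ = fockRep K n _ _ _
    simp [fockRep_cX, fockRep_cY, fockY_single, LinearMap.sum_apply, apply_ite, fockX_single]

/-- For `n = 1` in `K` the Cohn algebra has a normalized trace vanishing on the ideal `M`. -/
lemma exists_cohn_trace (hn : (n : K) = 1) :
    ∃ t : CohnAlgebra K n →ₗ[K] K, t 1 = 1 ∧ (∀ a b, t (a * b) = t (b * a)) ∧
      ∀ a, t (a * ∑ i, cX K n i * cY K n i) = t a := by
  have hlim (a : CohnAlgebra K n) :
      ∃ c, ∀ᶠ N in Filter.atTop, partialTrace K n N a = c := by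
    obtain ⟨k, hk⟩ := partialTrace_succ_eventually hn a
    refine ⟨partialTrace K n k a, Filter.eventually_atTop.mpr ⟨k, fun N hN => ?_⟩⟩
    induction N, hN using Nat.le_induction with
    | base => rfl
    | succ N hN ih => rw [hk N hN, ih]
  choose t ht using hlim
  have huniq {a : CohnAlgebra K n} {c : K}
      (h : ∀ᶠ N in Filter.atTop, partialTrace K n N a = c) : t a = c := by
    obtain ⟨N, h1, h2⟩ := ((ht a).and h).exists
    rw [← h1, h2]
  let τ : CohnAlgebra K n →ₗ[K] K :=
    { toFun := t
      map_add' a b := huniq (by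
        filter_upwards [ht a, ht b] with N h1 h2
        rw [map_add, h1, h2])
      map_smul' c a := huniq (by
        filter_upwards [ht a] with N h1
        simp [h1]) }
  refine ⟨τ, huniq (.of_forall (partialTrace_one hn)), fun a => ?_, fun a => huniq ?_⟩
  · induction a using cohn_induction with
    | halg r => intro b; rw [Algebra.commutes]
    | hX i =>
      intro b
      refine huniq ?_
      filter_upwards [(Filter.tendsto_sub_atTop_nat 1).eventually (ht (b * cX K n i)),
        Filter.eventually_ge_atTop 1] with N h1 hN
      obtain ⟨N, rfl⟩ := Nat.exists_eq_add_of_le' hN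
      rw [partialTrace_cX_mul]
      exact h1
    | hY i =>
      intro b
      refine huniq ?_
      filter_upwards [(Filter.tendsto_add_atTop_nat 1).eventually (ht (b * cY K n i))] with N h1
      rw [partialTrace_cY_mul]
      exact h1
    | hadd a c ha hc => intro b; rw [add_mul, mul_add, map_add, map_add, ha, hc]
    | hmul a c ha hc => intro b; rw [mul_assoc, ha, mul_assoc, hc, mul_assoc]
  · filter_upwards [ht a, Filter.eventually_ge_atTop 1] with N h1 hN
    rw [partialTrace_mul_sum a hN, h1]
    rfl

/-- For `n = 1` in `K` the Leavitt algebra has a normalized trace. -/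
lemma exists_leavitt_trace (hn : (n : K) = 1) :
    ∃ t : LeavittAlgebra K n →ₗ[K] K, t 1 = 1 ∧ ∀ a b, t (a * b) = t (b * a) := by
  obtain ⟨t, ht1, htr, htM⟩ := exists_cohn_trace (K := K) (n := n) hn
  have hrel {a b : CohnAlgebra K n} (hab : RingQuot.Rel (LeavittRel K n) a b) :
      ∀ c, t (c * a) = t (c * b) := by
    induction hab with
    | of hxy =>
      obtain ⟨⟩ := hxy
      intro c
      rw [htM, mul_one]
    | add_left _ ih => intro c; rw [mul_add, mul_add, map_add, map_add, ih]
    | mul_left _ ih => intro c; rw [← mul_assoc, htr, ← mul_assoc, ih, mul_assoc, htr, mul_assoc]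
    | mul_right _ ih => intro c; rw [← mul_assoc, ih, mul_assoc]
  have hker {a b : CohnAlgebra K n} (hab : leavittQuot K n a = leavittQuot K n b) :
      t a = t b := by
    have hmk : RingQuot.mkRingHom (LeavittRel K n) a = RingQuot.mkRingHom (LeavittRel K n) b := by
      rw [← RingQuot.mkAlgHom_coe K]
      exact hab
    simp only [RingQuot.mkRingHom_def, RingHom.coe_mk, MonoidHom.coe_mk, OneHom.coe_mk,
      RingQuot.mk.injEq] at hmk
    have hgen := Quot.eqvGen_exact hmk
    clear hab hmk
    induction hgen with
    | rel a b h => simpa using hrel h 1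
    | refl => rfl
    | symm _ _ _ ih => exact ih.symm
    | trans _ _ _ _ _ ih₁ ih₂ => exact ih₁.trans ih₂
  have hsurj : Function.Surjective (leavittQuot K n) := RingQuot.mkAlgHom_surjective K _
  have hg := Function.surjInv_eq hsurj
  set g := Function.surjInv hsurj
  have htg (a : CohnAlgebra K n) : t (g (leavittQuot K n a)) = t a := hker (hg _)
  refine ⟨{ toFun a := t (g a), map_add' a b := ?_, map_smul' c a := ?_ }, ?_, fun a b => ?_⟩
  · rw [← map_add]
    exact hker (by rw [map_add, hg, hg, hg])
  · rw [RingHom.id_apply, ← map_smul]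
    exact hker (by rw [map_smul, hg, hg])
  · change t (g 1) = 1
    rw [← map_one (leavittQuot K n), htg, ht1]
  · change t (g (a * b)) = t (g (b * a))
    obtain ⟨a, rfl⟩ := hsurj a
    obtain ⟨b, rfl⟩ := hsurj b
    rw [← map_mul, ← map_mul, htg, htg, htr]

end Trace

lemma isLeavittFamily_leavittQuot (K : Type) [Field K] (n : ℕ) :
    IsLeavittFamily (fun i => leavittQuot K n (cX K n i))
      (fun i => leavittQuot K n (cY K n i)) where
  mul_eq i j := by
    rw [← map_mul, cX, cY, ← map_mul, RingQuot.mkAlgHom_rel K (CohnRel.rel i j)]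
    split_ifs <;> simp
  sum_eq := by
    simp only [← map_mul, ← map_sum]
    rw [← map_one (leavittQuot K n)]
    exact RingQuot.mkAlgHom_rel K LeavittRel.rel

lemma adjoin_leavittQuot_eq_top (K : Type) [Field K] (n : ℕ) :
    Algebra.adjoin K (Set.range (fun i => leavittQuot K n (cX K n i)) ∪
      Set.range (fun i => leavittQuot K n (cY K n i))) = ⊤ := by
  rw [eq_top_iff]
  rintro a -
  obtain ⟨a, rfl⟩ : ∃ b, leavittQuot K n b = a := RingQuot.mkAlgHom_surjective K _ a
  induction a using cohn_induction with
  | halg r =>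
    rw [AlgHom.commutes]
    exact Subalgebra.algebraMap_mem _ r
  | hX i => exact Algebra.subset_adjoin (.inl ⟨i, rfl⟩)
  | hY i => exact Algebra.subset_adjoin (.inr ⟨i, rfl⟩)
  | hadd a b ha hb =>
    rw [map_add]
    exact add_mem ha hb
  | hmul a b ha hb =>
    rw [map_mul]
    exact mul_mem ha hb

lemma IsLeavittFamily.scalar {ι R : Type*} [Fintype ι] [DecidableEq ι] [Ring R] {X Y : ι → R}
    (h : IsLeavittFamily X Y) (d : ℕ) :
    IsLeavittFamily (fun i => Matrix.scalar (Fin d) (X i))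
      (fun i => Matrix.scalar (Fin d) (Y i)) where
  mul_eq i j := by
    rw [← map_mul, h.mul_eq]
    split_ifs <;> simp
  sum_eq := by
    simp only [← map_mul, ← map_sum, h.sum_eq, map_one]

/-- `(n - 1) 1` is a sum of commutators in a ring with a Leavitt family of size `n`. -/
lemma IsLeavittFamily.one_mem_derivedSeries_one {ι K R : Type*} [Fintype ι] [DecidableEq ι]
    [Field K] [Ring R] [Algebra K R] {X Y : ι → R} (h : IsLeavittFamily X Y)
    (hcard : (Fintype.card ι : K) ≠ 1) : (1 : R) ∈ LieAlgebra.derivedSeries K R 1 := by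
  have hsum : ∑ i, (Y i * X i - X i * Y i) ∈ (LieAlgebra.derivedSeries K R 1).toSubmodule :=
    Submodule.sum_mem _ fun i _ => commutator_mem_derivedSeries_one (Y i) (X i)
  have heq : ∑ i, (Y i * X i - X i * Y i) = ((Fintype.card ι : K) - 1) • (1 : R) := by
    rw [Finset.sum_sub_distrib, h.sum_eq]
    simp [h.mul_self, Algebra.smul_def]
  rw [heq] at hsum
  exact (Submodule.smul_mem_iff _ (sub_ne_zero.mpr hcard)).mp hsum

/-- The identity matrix of size `d = 0` in `K` is a sum of commutators. -/
lemma Matrix.one_mem_derivedSeries_one {K A : Type*} [Field K] [Ring A] [Algebra K A] {d : ℕ}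
    (hd : 1 ≤ d) (hd0 : (d : K) = 0) :
    (1 : Matrix (Fin d) (Fin d) A) ∈
      LieAlgebra.derivedSeries K (Matrix (Fin d) (Fin d) A) 1 := by
  let o : Fin d := ⟨0, hd⟩
  have hdA : (d : A) = 0 := by simpa using congrArg (algebraMap K A) hd0
  have hsum : ∑ i, (Matrix.single i o (1 : A) * Matrix.single o i 1 -
      Matrix.single o i 1 * Matrix.single i o 1) ∈
        (LieAlgebra.derivedSeries K (Matrix (Fin d) (Fin d) A) 1).toSubmodule :=
    Submodule.sum_mem _ fun i _ => commutator_mem_derivedSeries_one _ _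
  convert hsum
  simp only [Matrix.single_mul_single_same, mul_one, Finset.sum_sub_distrib, Finset.sum_const,
    Finset.card_univ, Fintype.card_fin]
  rw [Matrix.sum_single_one, Matrix.smul_single]
  simp [hdA]

/-- A trace on `A` with `t 1 = 1` shows that the identity matrix of size `d ≠ 0` in `K` is not a
sum of commutators. -/
lemma Matrix.one_notMem_derivedSeries_one {K A : Type*} [Field K] [Ring A] [Algebra K A] {d : ℕ}
    (hd0 : (d : K) ≠ 0) (t : A →ₗ[K] K) (ht1 : t 1 = 1) (htr : ∀ a b, t (a * b) = t (b * a)) :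
    (1 : Matrix (Fin d) (Fin d) A) ∉
      LieAlgebra.derivedSeries K (Matrix (Fin d) (Fin d) A) 1 := by
  intro h1
  have hker := derivedSeries_one_toSubmodule_le
    (P := LinearMap.ker (t ∘ₗ Matrix.traceLinearMap (Fin d) K A)) (fun a b => by
      rw [LinearMap.mem_ker, LinearMap.comp_apply, Matrix.traceLinearMap_apply, Matrix.trace_sub,
        map_sub, sub_eq_zero]
      simp only [Matrix.trace, Matrix.diag_apply, Matrix.mul_apply, map_sum]
      rw [Finset.sum_comm]
      exact Finset.sum_congr rfl fun i _ => Finset.sum_congr rfl fun j _ => htr _ _) h1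
  rw [LinearMap.mem_ker, LinearMap.comp_apply, Matrix.traceLinearMap_apply, Matrix.trace_one,
    Fintype.card_fin, ← nsmul_one d, map_nsmul, ht1, nsmul_one] at hker
  exact hd0 hker

lemma IsLeavittFamily.isSimple_derivedSeries_one_matrix {ι K A : Type*} [Fintype ι]
    [DecidableEq ι] [Field K] [Ring A] [IsSimpleRing A] [Algebra K A] {X Y : ι → A}
    (h : IsLeavittFamily X Y) (hcard : 3 ≤ Fintype.card ι) {d : ℕ} (hd : 1 ≤ d)
    (h1 : (1 : Matrix (Fin d) (Fin d) A) ∉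
      LieAlgebra.derivedSeries K (Matrix (Fin d) (Fin d) A) 1) :
    LieAlgebra.IsSimple K (LieAlgebra.derivedSeries K (Matrix (Fin d) (Fin d) A) 1) := by
  have : Nonempty (Fin d) := ⟨⟨0, hd⟩⟩
  exact (h.scalar d).isSimple_derivedSeries_one hcard h1

/-- Theorem 3.8 (main theorem): `[M_d(L_K(n))⁻, M_d(L_K(n))⁻]` is a simple Lie
algebra iff `char K ∣ n - 1` and `char K ∤ d`.  Here `[S⁻,S⁻]` is the derived
Lie ideal `⁅⊤,⊤⁆` of the Lie algebra associated to the associative algebra `S`. -/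
theorem main_theorem (K : Type) [Field K] (n d : ℕ) (hn : 2 ≤ n) (hd : 1 ≤ d) :
    LieAlgebra.IsSimple K
      (LieAlgebra.derivedSeries K (Matrix (Fin d) (Fin d) (LeavittAlgebra K n)) 1) ↔
    ((n - 1 : ℕ) : K) = 0 ∧ (d : K) ≠ 0 := by
  have hfam := (isLeavittFamily_leavittQuot K n).scalar d
  have hn1 : ((n - 1 : ℕ) : K) = 0 ↔ (n : K) = 1 := by
    rw [Nat.cast_sub (by omega), Nat.cast_one, sub_eq_zero]
  rw [hn1]
  constructor
  · intro hs
    refine ⟨?_, fun hd0 => not_isSimple_of_one_mem (Matrix.one_mem_derivedSeries_one hd hd0) hs⟩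
    by_contra hne
    exact not_isSimple_of_one_mem (hfam.one_mem_derivedSeries_one (by simpa using hne)) hs
  · rintro ⟨hn1, hd0⟩
    obtain ⟨t, ht1, htr⟩ := exists_leavitt_trace hn1
    have hn3 : 3 ≤ n := by
      by_contra hlt
      obtain rfl : n = 2 := by omega
      rw [Nat.cast_ofNat, ← one_add_one_eq_two, add_eq_left] at hn1
      exact one_ne_zero hn1
    have : Nontrivial (LeavittAlgebra K n) := ⟨1, 0, fun h => by simp [h] at ht1⟩
    have : Nontrivial (Fin n) := Fin.nontrivial_iff_two_le.mpr hn
    have := (isLeavittFamily_leavittQuot K n).isSimpleRing (adjoin_leavittQuot_eq_top K n)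
    exact (isLeavittFamily_leavittQuot K n).isSimple_derivedSeries_one_matrix
      (by simpa using hn3) hd (Matrix.one_notMem_derivedSeries_one hd0 t ht1 htr)
end
end

section
/- Let K be any field and let n ≥ 2 be an integer. Then the Lie algebra [L_K(n)⁻, L_K(n)⁻] is a simple Lie algebra if and only if char(K) divides n−1 (i.e. (n−1)·1_K = 0 in K). -/
noncomputable section

open scoped BigOperators

attribute [local instance 100] LieRing.ofAssociativeRing

/-- The span of all commutators of an algebra. -/
def commSpan (K A : Type*) [Field K] [Ring A] [Algebra K A] : Submodule K A :=
  Submodule.span K {z | ∃ a b : A, z = a * b - b * a}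

lemma comm_mem_commSpan (K : Type*) {A : Type*} [Field K] [Ring A] [Algebra K A] (a b : A) :
    a * b - b * a ∈ commSpan K A :=
  Submodule.subset_span ⟨a, b, rfl⟩

/-- A family `x i, y i` with `y i * x j = δ i j` and `∑ x i * y i = 1`. -/
structure LeavittFamily {ι A : Type*} [Fintype ι] [DecidableEq ι] [Ring A] (x y : ι → A) :
    Prop where
  mul_eq : ∀ i j, y i * x j = if i = j then 1 else 0
  sum_eq : ∑ i, x i * y i = 1

namespace LeavittFamily

variable {K ι A : Type*} [Fintype ι] [DecidableEq ι] [Field K] [Ring A] [Algebra K A]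
  {x y : ι → A}

lemma mul_self (h : LeavittFamily x y) (i : ι) : y i * x i = 1 := by simp [h.mul_eq]

lemma mul_ne (h : LeavittFamily x y) {i j : ι} (hij : i ≠ j) : y i * x j = 0 := by
  simp [h.mul_eq, hij]

lemma prod (h : LeavittFamily x y) :
    LeavittFamily (fun p : ι × ι => x p.1 * x p.2) (fun p => y p.2 * y p.1) where
  mul_eq := by
    rintro ⟨i, j⟩ ⟨k, l⟩
    have e : y j * y i * (x k * x l) = y j * (y i * x k) * x l := by noncomm_ring
    simp only [e, h.mul_eq, Prod.mk.injEq]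
    by_cases hik : i = k <;> simp [hik, h.mul_eq]
  sum_eq := by
    rw [Fintype.sum_prod_type]
    have e (i j : ι) : x i * x j * (y j * y i) = x i * (x j * y j) * y i := by noncomm_ring
    simp only [e, ← Finset.mul_sum, ← Finset.sum_mul, h.sum_eq, mul_one]

/-! ### Products of the matrix-unit-like elements `x i * a * y j` -/

lemma unit_mul (h : LeavittFamily x y) (i j l : ι) (a b : A) :
    x i * a * y j * (x j * b * y l) = x i * (a * b) * y l := by
  have : x i * a * y j * (x j * b * y l) = x i * a * (y j * x j) * b * y l := by noncomm_ring
  rw [this, h.mul_self]; noncomm_ring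

lemma unit_mul_ne (h : LeavittFamily x y) (i l : ι) {j k : ι} (hjk : j ≠ k) (a b : A) :
    x i * a * y j * (x k * b * y l) = 0 := by
  have : x i * a * y j * (x k * b * y l) = x i * a * (y j * x k) * b * y l := by noncomm_ring
  rw [this, h.mul_ne hjk]; noncomm_ring

lemma comm_unit (h : LeavittFamily x y) {i j l : ι} (hil : i ≠ l) (a b : A) :
    x i * a * y j * (x j * b * y l) - x j * b * y l * (x i * a * y j) = x i * (a * b) * y l := by
  rw [h.unit_mul, h.unit_mul_ne _ _ hil.symm, sub_zero]

lemma unit_mem_commSpan (K : Type*) [Field K] [Algebra K A] (h : LeavittFamily x y) {i j : ι}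
    (hij : i ≠ j) (a : A) : x i * a * y j ∈ commSpan K A := by
  have := comm_mem_commSpan K (x i * 1 * y i) (x i * a * y j)
  rwa [h.comm_unit hij, one_mul] at this

lemma one_eq_zero_of_comm_eq_zero (h : LeavittFamily x y) {p q : ι} (hpq : p ≠ q)
    (e : x p * 1 * y q * (x q * 1 * y p) - x q * 1 * y p * (x p * 1 * y q) = 0) :
    (1 : A) = 0 := by
  rw [h.unit_mul, h.unit_mul, mul_one, mul_one, mul_one] at e
  calc (1 : A) = y p * x p * (y p * x p) - y p * x q * (y q * x p) := by
        rw [h.mul_self, h.mul_ne hpq, zero_mul, sub_zero, mul_one]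
    _ = y p * (x p * y p - x q * y q) * x p := by noncomm_ring
    _ = 0 := by rw [e, mul_zero, zero_mul]

lemma one_mem_commSpan (h : LeavittFamily x y) (hne : (Fintype.card ι : K) - 1 ≠ 0) :
    (1 : A) ∈ commSpan K A := by
  have hsum : ∑ i, (y i * x i - x i * y i) = ((Fintype.card ι : K) - 1) • (1 : A) := by
    rw [Finset.sum_sub_distrib, h.sum_eq, sub_smul]
    simp [h.mul_self, Algebra.smul_def]
  refine (Submodule.smul_mem_iff _ hne).mp ?_
  rw [← hsum]
  exact Submodule.sum_mem _ fun i _ => comm_mem_commSpan K _ _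

lemma eq_sum (h : LeavittFamily x y) (a : A) :
    a = ∑ i, ∑ j, x i * (y i * a * x j) * y j := by
  have e (i j : ι) : x i * (y i * a * x j) * y j = x i * y i * (a * (x j * y j)) := by noncomm_ring
  simp only [e, ← Finset.mul_sum, ← Finset.sum_mul, h.sum_eq, mul_one, one_mul]

/-! ### Lie ideals of the span of commutators -/

variable {U : Submodule K A}

/-- A Lie ideal with a nonzero off-diagonal element contains all off-diagonal elements. -/
lemma unit_mem_of_unit_mem (h : LeavittFamily x y) (hcard : 5 ≤ Fintype.card ι)
    (hs : ∀ a : A, a ≠ 0 → ∃ u v, u * a * v = 1)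
    (hU : ∀ u ∈ U, ∀ w ∈ commSpan K A, u * w - w * u ∈ U)
    {i j : ι} {d : A} (hd : d ≠ 0) (hm : x i * d * y j ∈ U)
    {k l : ι} (hkl : k ≠ l) (r : A) : x k * r * y l ∈ U := by
  have right {i j k : ι} {a : A} (b : A) (hik : i ≠ k) (hjk : j ≠ k) (hm : x i * a * y j ∈ U) :
      x i * (a * b) * y k ∈ U := by
    have := hU _ hm _ (h.unit_mem_commSpan K hjk b)
    rwa [h.comm_unit hik] at this
  have left {i j k : ι} {a : A} (b : A) (hkj : k ≠ j) (hki : k ≠ i) (hm : x i * a * y j ∈ U) :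
      x k * (b * a) * y j ∈ U := by
    have := U.neg_mem (hU _ hm _ (h.unit_mem_commSpan K hki b))
    rwa [neg_sub, h.comm_unit hkj] at this
  have avoid (s : Finset ι) (hc : s.card ≤ 4) : ∃ p, p ∉ s := by
    obtain ⟨p, -, hp⟩ := Finset.exists_mem_notMem_of_card_lt_card
      (s := s) (t := Finset.univ) (by rw [Finset.card_univ]; omega)
    exact ⟨p, hp⟩
  obtain ⟨u, v, huv⟩ := hs d hd
  obtain ⟨q, hq⟩ := avoid {i, j, k, l} Finset.card_le_four
  obtain ⟨p, hp⟩ := avoid {i, q, k, l} Finset.card_le_four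
  simp only [Finset.mem_insert, Finset.mem_singleton, not_or] at hq hp
  have h1 := right (v * r) (Ne.symm hq.1) (Ne.symm hq.2.1) hm
  have h2 := left u hp.2.1 hp.1 h1
  rw [show u * (d * (v * r)) = u * d * v * r by noncomm_ring, huv, one_mul] at h2
  have h3 := left 1 (Ne.symm hq.2.2.1) (Ne.symm hp.2.2.1) h2
  have h4 := right 1 hkl hq.2.2.2 h3
  simpa using h4

/-- A Lie ideal containing all off-diagonal elements contains all commutators. -/
lemma commSpan_le (h : LeavittFamily x y) (hcard : 5 ≤ Fintype.card ι)
    (hU : ∀ u ∈ U, ∀ w ∈ commSpan K A, u * w - w * u ∈ U)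
    (hoff : ∀ k l, k ≠ l → ∀ r, x k * r * y l ∈ U) : commSpan K A ≤ U := by
  have diag {k l : ι} (hkl : k ≠ l) (a b : A) : x k * (a * b) * y k - x l * (b * a) * y l ∈ U := by
    have := hU _ (hoff k l hkl a) _ (h.unit_mem_commSpan K hkl.symm b)
    rwa [h.unit_mul, h.unit_mul] at this
  have units (i j k l : ι) (a b : A) :
      x i * a * y j * (x k * b * y l) - x k * b * y l * (x i * a * y j) ∈ U := by
    by_cases hij : i = j
    · subst hij
      by_cases hkl : k = l
      · subst hkl
        by_cases hik : i = k
        · subst hik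
          have : Nontrivial ι := Fintype.one_lt_card_iff_nontrivial.mp (by omega)
          obtain ⟨l, hl⟩ := exists_ne i
          have := U.sub_mem (diag hl.symm a b) (diag hl.symm (b * a) 1)
          rw [h.unit_mul, h.unit_mul]
          simpa using this
        · rw [h.unit_mul_ne _ _ hik, h.unit_mul_ne _ _ (Ne.symm hik), sub_zero]
          exact U.zero_mem
      · by_cases hik : i = k
        · subst hik
          rw [h.unit_mul, h.unit_mul_ne _ _ (Ne.symm hkl), sub_zero]
          exact hoff _ _ hkl _
        · rw [h.unit_mul_ne _ _ hik, zero_sub]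
          by_cases hil : i = l
          · subst hil
            rw [h.unit_mul]
            exact U.neg_mem (hoff _ _ hkl _)
          · rw [h.unit_mul_ne _ _ (Ne.symm hil)]
            simp
    · by_cases hkl : k = l
      · subst hkl
        by_cases hjk : j = k
        · subst hjk
          rw [h.unit_mul, h.unit_mul_ne _ _ (Ne.symm hij), sub_zero]
          exact hoff _ _ hij _
        · rw [h.unit_mul_ne _ _ hjk, zero_sub]
          by_cases hik : i = k
          · subst hik
            rw [h.unit_mul]
            exact U.neg_mem (hoff _ _ hij _)
          · rw [h.unit_mul_ne _ _ (Ne.symm hik)]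
            simp
      · exact hU _ (hoff i j hij a) _ (h.unit_mem_commSpan K hkl b)
  refine Submodule.span_le.mpr ?_
  rintro _ ⟨a, b, rfl⟩
  have key (a b : A) (hb : ∀ i j c, x i * c * y j * b - b * (x i * c * y j) ∈ U) :
      a * b - b * a ∈ U := by
    rw [h.eq_sum a]
    simp only [Finset.sum_mul, Finset.mul_sum, ← Finset.sum_sub_distrib]
    exact U.sum_mem fun i _ => U.sum_mem fun j _ => hb i j _
  refine key a b fun i j c => ?_
  have := U.neg_mem (key b (x i * c * y j) fun k l d => units _ _ _ _ _ _)
  rwa [neg_sub] at this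

/-- A nonzero Lie ideal of the span of commutators contains a nonzero off-diagonal element,
provided that `1` is not a sum of commutators. -/
lemma exists_unit_mem (h : LeavittFamily x y) (hcard : 5 ≤ Fintype.card ι)
    (hs : ∀ a : A, a ≠ 0 → ∃ u v, u * a * v = 1) (h1 : (1 : A) ∉ commSpan K A)
    (hU : ∀ u ∈ U, ∀ w ∈ commSpan K A, u * w - w * u ∈ U)
    {u : A} (hu : u ∈ U) (hW : u ∈ commSpan K A) (hu0 : u ≠ 0) :
    ∃ i j d, i ≠ j ∧ d ≠ 0 ∧ x i * d * y j ∈ U := by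
  have avoid (s : Finset ι) (hc : s.card ≤ 4) : ∃ p, p ∉ s := by
    obtain ⟨p, -, hp⟩ := Finset.exists_mem_notMem_of_card_lt_card
      (s := s) (t := Finset.univ) (by rw [Finset.card_univ]; omega)
    exact ⟨p, hp⟩
  by_contra! hno
  have hoff (j k : ι) (hjk : j ≠ k) : y j * u * x k = 0 := by
    by_contra hc
    obtain ⟨i, hi⟩ := avoid {j, k} (Finset.card_le_two.trans (by norm_num))
    obtain ⟨l, hl⟩ := avoid {i, j, k} (Finset.card_le_three.trans (by norm_num))
    obtain ⟨p, hp⟩ := avoid {i, j, k, l} Finset.card_le_four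
    simp only [Finset.mem_insert, Finset.mem_singleton, not_or] at hi hl hp
    refine hno p l (y j * u * x k) hp.2.2.2 hc ?_
    have m1 := hU _ hu _ (h.unit_mem_commSpan K hi.1 1)
    have m2 := hU _ m1 _ (h.unit_mem_commSpan K (Ne.symm hl.2.2) 1)
    have m3 := hU _ m2 _ (h.unit_mem_commSpan K hp.1 1)
    convert m3 using 1
    set α := x i * 1 * y j with hα
    set β := x k * 1 * y l with hβ
    set γ := x p * 1 * y i with hγ
    have z1 : α * β = 0 := h.unit_mul_ne _ _ hjk _ _
    have z2 : β * α = 0 := h.unit_mul_ne _ _ hl.1 _ _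
    have z3 : β * γ = 0 := h.unit_mul_ne _ _ (Ne.symm hp.2.2.2) _ _
    have z4 : α * γ = 0 := h.unit_mul_ne _ _ (Ne.symm hp.2.1) _ _
    have z5 : γ * β = 0 := h.unit_mul_ne _ _ hi.2 _ _
    have z6 : γ * α = x p * 1 * y j := by rw [hγ, hα, h.unit_mul, one_mul]
    calc x p * (y j * u * x k) * y l = (x p * 1 * y j) * u * β := by
          rw [hβ]; noncomm_ring
      _ = γ * α * u * β := by rw [z6]
      _ = u * (α * β) * γ - α * u * (β * γ) - β * u * (α * γ) + (β * α) * u * γ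
          - (γ * u * (α * β) - γ * α * u * β - (γ * β) * u * α + γ * (β * α) * u) := by
          rw [z1, z2, z3, z4, z5]; noncomm_ring
      _ = _ := by noncomm_ring
  have hdiag : u = ∑ i, x i * (y i * u * x i) * y i := by
    conv_lhs => rw [h.eq_sum u]
    refine Finset.sum_congr rfl fun i _ => ?_
    refine Finset.sum_eq_single i (fun j _ hji => ?_) (by simp)
    rw [hoff i j (Ne.symm hji)]; simp
  have hcomm (i j : ι) (hij : i ≠ j) (a : A) : y i * u * x i * a = a * (y j * u * x j) := by
    by_contra hne
    refine hno i j _ hij (sub_ne_zero.mpr hne) ?_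
    have := hU _ hu _ (h.unit_mem_commSpan K hij a)
    convert this using 1
    have e1 : u * x i = x i * (y i * u * x i) := by
      conv_lhs => rw [hdiag, Finset.sum_mul]
      rw [Finset.sum_eq_single i]
      · rw [mul_assoc, h.mul_self, mul_one]
      · intro k _ hk
        rw [mul_assoc, h.mul_ne hk, mul_zero]
      · simp
    have e2 : y j * u = (y j * u * x j) * y j := by
      conv_lhs => rw [hdiag, Finset.mul_sum]
      rw [Finset.sum_eq_single j]
      · rw [← mul_assoc, ← mul_assoc, h.mul_self, one_mul]
      · intro k _ hk
        rw [← mul_assoc, ← mul_assoc, h.mul_ne (Ne.symm hk), zero_mul, zero_mul]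
      · simp
    have e3 : u * (x i * a * y j) - x i * a * y j * u =
        (u * x i) * a * y j - x i * a * (y j * u) := by noncomm_ring
    conv_rhs => rw [e3, e1, e2]
    noncomm_ring
  have hequal (i j : ι) : y i * u * x i = y j * u * x j := by
    by_cases hij : i = j
    · rw [hij]
    · simpa using hcomm i j hij 1
  have : Nontrivial ι := Fintype.one_lt_card_iff_nontrivial.mp (by omega)
  obtain ⟨p, q, hpq⟩ := exists_pair_ne ι
  have hcent (a : A) : y p * u * x p * a = a * (y p * u * x p) := by
    rw [hcomm p q hpq a, hequal p q]
  have hup : u = y p * u * x p := by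
    conv_lhs => rw [hdiag]
    simp only [hequal _ p, ← hcent, mul_assoc _ (x _) (y _)]
    rw [← Finset.mul_sum, h.sum_eq, mul_one]
  rw [← hup] at hcent
  obtain ⟨s, t, hst⟩ := hs u hu0
  have hinv : u * (s * t) = 1 := by rw [← hst, ← hcent s]; noncomm_ring
  have hinv' : s * t * u = 1 := by rw [← hcent, hinv]
  have hbc (a : A) : s * t * a = a * (s * t) := by
    calc s * t * a = s * t * (a * u) * (s * t) := by
          rw [mul_assoc (s * t), mul_assoc a, hinv, mul_one]
      _ = _ := by rw [← hcent, ← mul_assoc (s * t) u, hinv', one_mul]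
  refine h1 ?_
  rw [← hinv]
  clear hinv hinv' hup hcent hequal hcomm hdiag hoff hu hu0 hst
  induction hW using Submodule.span_induction with
  | mem z hz =>
    obtain ⟨a, b, rfl⟩ := hz
    have := comm_mem_commSpan K a (b * (s * t))
    convert this using 1
    rw [mul_assoc b, hbc a]
    noncomm_ring
  | zero => simp
  | add a b _ _ ha hb => rw [add_mul]; exact add_mem ha hb
  | smul c a _ ha => rw [smul_mul_assoc]; exact Submodule.smul_mem _ _ ha

theorem lieIdeal_eq_bot_or_commSpan_le (h : LeavittFamily x y) (hcard : 5 ≤ Fintype.card ι)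
    (hs : ∀ a : A, a ≠ 0 → ∃ u v, u * a * v = 1) (h1 : (1 : A) ∉ commSpan K A)
    (hW : U ≤ commSpan K A) (hU : ∀ u ∈ U, ∀ w ∈ commSpan K A, u * w - w * u ∈ U) :
    U = ⊥ ∨ commSpan K A ≤ U := by
  refine or_iff_not_imp_left.mpr fun hbot => ?_
  obtain ⟨u, hu, hu0⟩ := Submodule.exists_mem_ne_zero_of_ne_bot hbot
  obtain ⟨i, j, d, -, hd, hm⟩ := h.exists_unit_mem hcard hs h1 hU hu (hW hu) hu0
  exact h.commSpan_le hcard hU fun k l hkl r =>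
    h.unit_mem_of_unit_mem hcard hs hU hd hm hkl r

end LeavittFamily

/-! ### Simplicity of the Leavitt algebra -/

/-- `b` is a polynomial of degree at most `m` in the elements `x i`. -/
def IsPolyDeg (K : Type*) {ι A : Type*} [Fintype ι] [Field K] [Ring A] [Algebra K A] (x : ι → A) :
    ℕ → A → Prop
  | 0, b => ∃ c : K, b = algebraMap K A c
  | m + 1, b => ∃ (c : K) (f : ι → A), (∀ i, IsPolyDeg K x m (f i)) ∧
      b = algebraMap K A c + ∑ i, x i * f i

/-- `a * x_J` is a polynomial in the elements `x i` for all words `J` of length `m`. -/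
def IsPolyAfter (K : Type*) {ι A : Type*} [Fintype ι] [Field K] [Ring A] [Algebra K A]
    (x : ι → A) : ℕ → A → Prop
  | 0, a => ∃ d, IsPolyDeg K x d a
  | m + 1, a => ∀ j, IsPolyAfter K x m (a * x j)

section

variable {K ι A : Type*} [Fintype ι] [Field K] [Ring A] [Algebra K A] {x y : ι → A}

lemma IsPolyDeg.const (x : ι → A) (m : ℕ) (c : K) :
    IsPolyDeg K x m (algebraMap K A c) := by
  induction m generalizing c with
  | zero => exact ⟨c, rfl⟩
  | succ m ih => exact ⟨c, 0, fun i => by simpa using ih 0, by simp⟩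

lemma IsPolyDeg.succ {m : ℕ} {b : A} (hb : IsPolyDeg K x m b) : IsPolyDeg K x (m + 1) b := by
  induction m generalizing b with
  | zero => obtain ⟨c, rfl⟩ := hb; exact .const x 1 c
  | succ m ih =>
    obtain ⟨c, f, hf, rfl⟩ := hb
    exact ⟨c, f, fun i => ih (hf i), rfl⟩

lemma IsPolyDeg.mono {m k : ℕ} (hmk : m ≤ k) {b : A} (hb : IsPolyDeg K x m b) :
    IsPolyDeg K x k b := by
  induction hmk with
  | refl => exact hb
  | step _ ih => exact ih.succ

lemma IsPolyDeg.add {m : ℕ} {a b : A} (ha : IsPolyDeg K x m a) (hb : IsPolyDeg K x m b) :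
    IsPolyDeg K x m (a + b) := by
  induction m generalizing a b with
  | zero =>
    obtain ⟨c, rfl⟩ := ha
    obtain ⟨d, rfl⟩ := hb
    exact ⟨c + d, by simp⟩
  | succ m ih =>
    obtain ⟨c, f, hf, rfl⟩ := ha
    obtain ⟨d, g, hg, rfl⟩ := hb
    refine ⟨c + d, f + g, fun i => ih (hf i) (hg i), ?_⟩
    simp only [map_add, Pi.add_apply, mul_add, Finset.sum_add_distrib]
    abel

lemma IsPolyDeg.mul_algebraMap {m : ℕ} {a : A} (ha : IsPolyDeg K x m a) (c : K) :
    IsPolyDeg K x m (a * algebraMap K A c) := by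
  induction m generalizing a with
  | zero => obtain ⟨d, rfl⟩ := ha; exact ⟨d * c, by simp⟩
  | succ m ih =>
    obtain ⟨d, f, hf, rfl⟩ := ha
    exact ⟨d * c, fun i => f i * algebraMap K A c, fun i => ih (hf i), by
      simp [add_mul, Finset.sum_mul, mul_assoc]⟩

lemma IsPolyDeg.mul_gen [DecidableEq ι] {m : ℕ} {a : A} (ha : IsPolyDeg K x m a) (j : ι) :
    IsPolyDeg K x (m + 1) (a * x j) := by
  have base (m : ℕ) (c : K) : IsPolyDeg K x (m + 1) (algebraMap K A c * x j) := by
    refine ⟨0, fun i => if i = j then algebraMap K A c else 0, fun i => ?_, ?_⟩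
    · dsimp only
      split_ifs
      · exact .const x m c
      · simpa using IsPolyDeg.const x m (0 : K)
    · simp [Algebra.commutes]
  induction m generalizing a with
  | zero => obtain ⟨c, rfl⟩ := ha; exact base 0 c
  | succ m ih =>
    obtain ⟨c, f, hf, rfl⟩ := ha
    rw [add_mul]
    refine (base _ c).add ⟨0, fun i => f i * x j, fun i => ih (hf i), ?_⟩
    simp [Finset.sum_mul, mul_assoc]

lemma IsPolyAfter.add {m : ℕ} {a b : A} (ha : IsPolyAfter K x m a) (hb : IsPolyAfter K x m b) :
    IsPolyAfter K x m (a + b) := by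
  induction m generalizing a b with
  | zero =>
    obtain ⟨d, hd⟩ := ha
    obtain ⟨e, he⟩ := hb
    exact ⟨max d e, (hd.mono (le_max_left _ _)).add (he.mono (le_max_right _ _))⟩
  | succ m ih => intro j; rw [add_mul]; exact ih (ha j) (hb j)

lemma IsPolyAfter.mul_gen [DecidableEq ι] {m : ℕ} {a : A} (ha : IsPolyAfter K x m a) (j : ι) :
    IsPolyAfter K x m (a * x j) := by
  induction m generalizing a j with
  | zero => obtain ⟨d, hd⟩ := ha; exact ⟨d + 1, hd.mul_gen j⟩
  | succ m ih => intro k; exact ih (ha j) k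

lemma IsPolyAfter.mono [DecidableEq ι] {m k : ℕ} (hmk : m ≤ k) {a : A}
    (ha : IsPolyAfter K x m a) : IsPolyAfter K x k a := by
  induction hmk with
  | refl => exact ha
  | step _ ih => exact fun j => ih.mul_gen j

lemma IsPolyAfter.mul_algebraMap {m : ℕ} {a : A} (ha : IsPolyAfter K x m a) (c : K) :
    IsPolyAfter K x m (a * algebraMap K A c) := by
  induction m generalizing a with
  | zero => obtain ⟨d, hd⟩ := ha; exact ⟨d, hd.mul_algebraMap c⟩
  | succ m ih =>
    intro j
    rw [mul_assoc, Algebra.commutes, ← mul_assoc]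
    exact ih (ha j)

end

namespace LeavittFamily

variable {K ι A : Type*} [Fintype ι] [DecidableEq ι] [Field K] [Ring A] [Algebra K A]
  {x y : ι → A}

lemma isPolyAfter_mul_y (h : LeavittFamily x y) {m : ℕ} {a : A} (ha : IsPolyAfter K x m a)
    (i : ι) : IsPolyAfter K x (m + 1) (a * y i) := by
  intro j
  rw [mul_assoc, h.mul_eq]
  split_ifs
  · simpa using ha
  · simpa using ha.mul_algebraMap 0

lemma exists_isPolyAfter (h : LeavittFamily x y)
    (hgen : Algebra.adjoin K (Set.range x ∪ Set.range y) = ⊤) (a : A) :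
    ∃ m, IsPolyAfter K x m a := by
  have ha : a ∈ Algebra.adjoin K (Set.range x ∪ Set.range y) := hgen ▸ Algebra.mem_top
  suffices ∀ b : A, (∃ m, IsPolyAfter K x m b) → ∃ m, IsPolyAfter K x m (b * a) by
    simpa using this 1 ⟨0, 0, by simpa using IsPolyDeg.const x 0 (1 : K)⟩
  induction ha using Algebra.adjoin_induction with
  | mem z hz =>
    rintro b ⟨m, hm⟩
    rcases hz with ⟨i, rfl⟩ | ⟨i, rfl⟩
    · exact ⟨m, hm.mul_gen i⟩
    · exact ⟨m + 1, h.isPolyAfter_mul_y hm i⟩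
  | algebraMap c => rintro b ⟨m, hm⟩; exact ⟨m, hm.mul_algebraMap c⟩
  | add z w _ _ hz hw =>
    intro b hb
    obtain ⟨k, hk⟩ := hz b hb
    obtain ⟨l, hl⟩ := hw b hb
    rw [mul_add]
    exact ⟨max k l, (hk.mono (le_max_left _ _)).add (hl.mono (le_max_right _ _))⟩
  | mul z w _ _ hz hw => intro b hb; rw [← mul_assoc]; exact hw _ (hz b hb)

lemma pow_mul_pow (h : LeavittFamily x y) (p : ι) (m k : ℕ) :
    y p ^ m * x p ^ (m + k) = x p ^ k := by
  induction m with
  | zero => simp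
  | succ m ih =>
    calc y p ^ (m + 1) * x p ^ (m + 1 + k) = y p ^ m * (y p * x p) * x p ^ (m + k) := by
          rw [pow_succ, add_right_comm, pow_succ']; noncomm_ring
      _ = _ := by rw [h.mul_self, mul_one, ih]

lemma mul_pow_mul (h : LeavittFamily x y) {p q : ι} (hqp : q ≠ p) (k : ℕ) :
    y q * x p ^ (k + 1) = 0 := by
  rw [pow_succ', ← mul_assoc, h.mul_ne hqp, zero_mul]

lemma pow_succ_mul_sum (h : LeavittFamily x y) (p : ι) (M : ℕ) (f : ι → A) :
    y p ^ (M + 1) * ∑ i, x i * f i = y p ^ M * f p := by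
  rw [Finset.mul_sum, Finset.sum_eq_single p]
  · rw [pow_succ, mul_assoc, ← mul_assoc (y p), h.mul_self, one_mul]
  · intro i _ hi
    rw [pow_succ, mul_assoc, ← mul_assoc (y p), h.mul_ne (Ne.symm hi), zero_mul, mul_zero]
  · simp

lemma compress_eq_zero (h : LeavittFamily x y) {p q : ι} (hqp : q ≠ p) {m : ℕ} {b : A}
    (hb : IsPolyDeg K x m b) {M : ℕ} (hM : m ≤ M) (k : ℕ) :
    y q * (y p ^ M * b * x p ^ (M + (k + 1))) = 0 := by
  have const (M k : ℕ) (c : K) :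
      y q * (y p ^ M * algebraMap K A c * x p ^ (M + (k + 1))) = 0 := by
    rw [← Algebra.commutes, mul_assoc, h.pow_mul_pow, ← mul_assoc, ← Algebra.commutes, mul_assoc,
      h.mul_pow_mul hqp, mul_zero]
  induction m generalizing b M k with
  | zero => obtain ⟨c, rfl⟩ := hb; exact const M k c
  | succ m ih =>
    obtain ⟨c, f, hf, rfl⟩ := hb
    obtain ⟨M, rfl⟩ : ∃ N, M = N + 1 := ⟨M - 1, by omega⟩
    rw [mul_add, add_mul, mul_add, const, h.pow_succ_mul_sum, zero_add,
      show M + 1 + (k + 1) = M + (k + 1 + 1) by ring]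
    exact ih (hf p) (by omega) _

lemma exists_mul_eq_one_of_isPolyDeg [Nontrivial ι] (h : LeavittFamily x y) {m : ℕ} {b : A}
    (hb : IsPolyDeg K x m b) (hb0 : b ≠ 0) : ∃ u v, u * b * v = 1 := by
  induction m generalizing b with
  | zero =>
    obtain ⟨c, rfl⟩ := hb
    have hc : c ≠ 0 := by rintro rfl; simp at hb0
    exact ⟨algebraMap K A c⁻¹, 1, by rw [mul_one, ← map_mul, inv_mul_cancel₀ hc, map_one]⟩
  | succ m ih =>
    obtain ⟨c, f, hf, rfl⟩ := hb
    by_cases hc : c = 0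
    · subst hc
      obtain ⟨i, hi⟩ : ∃ i, f i ≠ 0 := by
        by_contra! hall
        simp [hall] at hb0
      obtain ⟨u, v, huv⟩ := ih (hf i) hi
      refine ⟨u * y i, v, ?_⟩
      have := h.pow_succ_mul_sum i 0 f
      rw [zero_add, pow_one, pow_zero, one_mul] at this
      rw [map_zero, zero_add, mul_assoc u, this, huv]
    · obtain ⟨p, q, hpq⟩ := exists_pair_ne ι
      have hz := h.compress_eq_zero hpq.symm (hf p) le_rfl 0
      have hone := h.pow_mul_pow p (m + 1) 0
      rw [add_zero, pow_zero] at hone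
      refine ⟨algebraMap K A c⁻¹ * y q * y p ^ (m + 1), x p ^ (m + 1) * x q, ?_⟩
      calc algebraMap K A c⁻¹ * y q * y p ^ (m + 1) * (algebraMap K A c + ∑ i, x i * f i) *
            (x p ^ (m + 1) * x q)
          = algebraMap K A c⁻¹ * (y q * y p ^ (m + 1) * algebraMap K A c) * x p ^ (m + 1) * x q +
            algebraMap K A c⁻¹ * (y q * ((y p ^ (m + 1) * ∑ i, x i * f i) * x p ^ (m + 1))) *
              x q := by noncomm_ring
        _ = algebraMap K A c⁻¹ * (algebraMap K A c * (y q * y p ^ (m + 1))) * x p ^ (m + 1) *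
              x q := by
            rw [h.pow_succ_mul_sum, ← Algebra.commutes, show m + 1 = m + (0 + 1) by ring, hz]
            simp
        _ = (algebraMap K A c⁻¹ * algebraMap K A c) *
              (y q * (y p ^ (m + 1) * x p ^ (m + 1)) * x q) := by noncomm_ring
        _ = 1 := by
            rw [← map_mul, inv_mul_cancel₀ hc, map_one, hone, mul_one, one_mul, h.mul_self]

theorem exists_mul_eq_one [Nontrivial ι] (h : LeavittFamily x y)
    (hgen : Algebra.adjoin K (Set.range x ∪ Set.range y) = ⊤) {a : A} (ha : a ≠ 0) :
    ∃ u v, u * a * v = 1 := by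
  obtain ⟨m, hm⟩ := h.exists_isPolyAfter hgen a
  induction m generalizing a with
  | zero =>
    obtain ⟨d, hd⟩ := hm
    exact h.exists_mul_eq_one_of_isPolyDeg hd ha
  | succ m ih =>
    obtain ⟨j, hj⟩ : ∃ j, a * x j ≠ 0 := by
      by_contra! hall
      apply ha
      rw [← mul_one a, ← h.sum_eq, Finset.mul_sum]
      simp [← mul_assoc, hall]
    obtain ⟨u, v, huv⟩ := ih hj (hm j)
    exact ⟨u, x j * v, by rw [← huv]; noncomm_ring⟩

/-- The monomials `x_I * y_J` span an algebra generated by a Leavitt family. -/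
theorem span_monomials (h : LeavittFamily x y)
    (hgen : Algebra.adjoin K (Set.range x ∪ Set.range y) = ⊤) :
    Submodule.span K {z | ∃ I J : List ι, z = (I.map x).prod * (J.map y).prod} = ⊤ := by
  rw [eq_top_iff]
  rintro a -
  set S := Submodule.span K {z | ∃ I J : List ι, z = (I.map x).prod * (J.map y).prod} with hS
  have ha : a ∈ Algebra.adjoin K (Set.range x ∪ Set.range y) := hgen ▸ Algebra.mem_top
  suffices ∀ b ∈ S, a * b ∈ S by
    simpa using this 1 (Submodule.subset_span ⟨[], [], by simp⟩)
  induction ha using Algebra.adjoin_induction with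
  | mem z hz =>
    intro b hb
    induction hb using Submodule.span_induction with
    | mem b hb =>
      obtain ⟨I, J, rfl⟩ := hb
      rcases hz with ⟨i, rfl⟩ | ⟨i, rfl⟩
      · exact Submodule.subset_span ⟨i :: I, J, by simp [mul_assoc]⟩
      · cases I with
        | nil => exact Submodule.subset_span ⟨[], i :: J, by simp⟩
        | cons k I =>
          rw [List.map_cons, List.prod_cons, mul_assoc, ← mul_assoc, h.mul_eq]
          split_ifs
          · exact Submodule.subset_span ⟨I, J, by simp⟩
          · simp
    | zero => simp
    | add b c _ _ hb hc => rw [mul_add]; exact S.add_mem hb hc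
    | smul c b _ hb => rw [mul_smul_comm]; exact S.smul_mem c hb
  | algebraMap c =>
    intro b hb
    rw [← Algebra.smul_def]
    exact S.smul_mem c hb
  | add z w _ _ hz hw => intro b hb; rw [add_mul]; exact S.add_mem (hz b hb) (hw b hb)
  | mul z w _ _ hz hw => intro b hb; rw [mul_assoc]; exact hz _ (hw b hb)

end LeavittFamily

/-! ### A trace on the Leavitt algebra -/

section Trace

variable (K : Type) [Field K] (n : ℕ)

/-- The functions of pairs of words on which the Leavitt algebra acts. -/
def wordFun : Submodule K (List (Fin n) → List (Fin n) → K) where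
  carrier := {f | ∀ I J, f I J = ∑ i, f (I ++ [i]) (i :: J)}
  zero_mem' := by simp
  add_mem' {f g} hf hg I J := by
    simp only [Pi.add_apply, Finset.sum_add_distrib, ← hf I J, ← hg I J]
  smul_mem' c f hf I J := by
    simp only [Pi.smul_apply, ← Finset.smul_sum, ← hf I J]

/-- The action of `x i` on functions of pairs of words. -/
def opX (i : Fin n) :
    (List (Fin n) → List (Fin n) → K) →ₗ[K] (List (Fin n) → List (Fin n) → K) where
  toFun f I J := match I with
    | [] => f [] (i :: J)
    | k :: I => if i = k then f I J else 0
  map_add' f g := by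
    funext I J
    cases I <;> simp [ite_add_ite]
  map_smul' c f := by
    funext I J
    cases I <;> simp

/-- The action of `y i` on functions of pairs of words. -/
def opY (i : Fin n) :
    (List (Fin n) → List (Fin n) → K) →ₗ[K] (List (Fin n) → List (Fin n) → K) where
  toFun f I J := f (i :: I) J
  map_add' _ _ := rfl
  map_smul' _ _ := rfl

variable {K n}

lemma opX_nil (i : Fin n) (f : List (Fin n) → List (Fin n) → K) (J : List (Fin n)) :
    opX K n i f [] J = f [] (i :: J) := rfl

lemma opX_cons (i k : Fin n) (f : List (Fin n) → List (Fin n) → K) (I J : List (Fin n)) :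
    opX K n i f (k :: I) J = if i = k then f I J else 0 := rfl

lemma opY_apply (i : Fin n) (f : List (Fin n) → List (Fin n) → K) (I J : List (Fin n)) :
    opY K n i f I J = f (i :: I) J := rfl

lemma opX_mem (i : Fin n) : ∀ f ∈ wordFun K n, opX K n i f ∈ wordFun K n := by
  intro f hf I J
  cases I with
  | nil => simp [opX_nil, opX_cons]
  | cons k I =>
    simp only [List.cons_append, opX_cons]
    split_ifs
    · exact hf I J
    · simp

lemma opY_mem (i : Fin n) : ∀ f ∈ wordFun K n, opY K n i f ∈ wordFun K n :=
  fun _ hf I J => hf (i :: I) J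

variable (K n)

/-- The representation of the Cohn algebra on functions of pairs of words. -/
def cohnRep : CohnAlgebra K n →ₐ[K] Module.End K (wordFun K n) :=
  RingQuot.liftAlgHom K ⟨FreeAlgebra.lift K (Sum.elim
    (fun i => (opX K n i).restrict (opX_mem i)) (fun i => (opY K n i).restrict (opY_mem i))), by
    rintro _ _ ⟨i, j⟩
    apply LinearMap.ext
    intro f
    apply Subtype.ext
    funext I J
    by_cases hij : i = j
    · subst hij
      simp [opY_apply, opX_cons]
    · simp [opY_apply, opX_cons, hij, Ne.symm hij]⟩

lemma cohnRep_cX (i : Fin n) : cohnRep K n (cX K n i) = (opX K n i).restrict (opX_mem i) := by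
  simp [cohnRep, cX]

lemma cohnRep_cY (i : Fin n) : cohnRep K n (cY K n i) = (opY K n i).restrict (opY_mem i) := by
  simp [cohnRep, cY]

/-- The representation of the Leavitt algebra on functions of pairs of words. -/
def leavittRep : LeavittAlgebra K n →ₐ[K] Module.End K (wordFun K n) :=
  RingQuot.liftAlgHom K ⟨cohnRep K n, by
    rintro _ _ ⟨⟩
    apply LinearMap.ext
    intro f
    apply Subtype.ext
    funext I J
    simp only [map_sum, map_mul, cohnRep_cX, cohnRep_cY, map_one]
    cases I with
    | nil =>
      simp [opX_nil, opY_apply]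
      exact (f.2 [] J).symm
    | cons k I => simp [opX_cons, opY_apply]⟩

/-- The image of `x_i` in the Leavitt algebra. -/
def lX (i : Fin n) : LeavittAlgebra K n := leavittQuot K n (cX K n i)

/-- The image of `y_i` in the Leavitt algebra. -/
def lY (i : Fin n) : LeavittAlgebra K n := leavittQuot K n (cY K n i)

lemma leavittRep_lX (i : Fin n) : leavittRep K n (lX K n i) = (opX K n i).restrict (opX_mem i) := by
  rw [← cohnRep_cX]
  simp [leavittRep, lX, leavittQuot]

lemma leavittRep_lY (i : Fin n) : leavittRep K n (lY K n i) = (opY K n i).restrict (opY_mem i) := by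
  rw [← cohnRep_cY]
  simp [leavittRep, lY, leavittQuot]

lemma leavittFamily : LeavittFamily (lX K n) (lY K n) where
  mul_eq i j := by
    have : cY K n i * cX K n j = if i = j then 1 else 0 := by
      rw [cX, cY, ← map_mul, RingQuot.mkAlgHom_rel K (CohnRel.rel i j)]
      split_ifs <;> simp
    rw [lX, lY, ← map_mul, this]
    split_ifs <;> simp
  sum_eq := by
    simp only [lX, lY, ← map_mul, ← map_sum]
    rw [leavittQuot, RingQuot.mkAlgHom_rel K LeavittRel.rel, map_one]

lemma adjoin_leavitt : Algebra.adjoin K (Set.range (lX K n) ∪ Set.range (lY K n)) = ⊤ := by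
  let φ := (leavittQuot K n).comp (RingQuot.mkAlgHom K (CohnRel K n))
  have hφ : Function.Surjective φ :=
    (RingQuot.mkAlgHom_surjective K (LeavittRel K n)).comp
      (RingQuot.mkAlgHom_surjective K (CohnRel K n))
  rw [← (AlgHom.range_eq_top φ).mpr hφ, ← Algebra.map_top, ← FreeAlgebra.adjoin_range_ι,
    AlgHom.map_adjoin]
  congr 1
  rw [← Set.range_comp]
  ext z
  simp only [Set.mem_union, Set.mem_range, Sum.exists]
  rfl

variable {K n}

/-- The function `(I, J) ↦ δ_{I, reverse J}`. -/
def diagFun (hn : (n : K) = 1) : wordFun K n :=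
  ⟨fun I J => if I = J.reverse then 1 else 0, fun I J => by
    by_cases hIJ : I = J.reverse <;> simp [hIJ, hn]⟩

/-- The trace on the Leavitt algebra, sending `x_I * y_J` to `δ_{I, reverse J}`. -/
def leavittTrace (hn : (n : K) = 1) : LeavittAlgebra K n →ₗ[K] K where
  toFun a := (leavittRep K n a (diagFun hn)).1 [] []
  map_add' a b := by simp
  map_smul' c a := by simp

lemma leavittTrace_monomial (hn : (n : K) = 1) (I J : List (Fin n)) :
    leavittTrace hn ((I.map (lX K n)).prod * (J.map (lY K n)).prod) =
      if I = J.reverse then 1 else 0 := by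
  have hX (I J : List (Fin n)) (f : wordFun K n) :
      (leavittRep K n (I.map (lX K n)).prod f).1 [] J = f.1 [] (I.reverse ++ J) := by
    induction I generalizing J with
    | nil => simp
    | cons i I ih =>
      rw [List.map_cons, List.prod_cons, map_mul, leavittRep_lX]
      have := ih (i :: J)
      simpa [opX_nil] using this
  have hY (J I L : List (Fin n)) (f : wordFun K n) :
      (leavittRep K n (J.map (lY K n)).prod f).1 I L = f.1 (J.reverse ++ I) L := by
    induction J generalizing I with
    | nil => simp
    | cons i J ih =>
      rw [List.map_cons, List.prod_cons, map_mul, leavittRep_lY]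
      have := ih (i :: I)
      simpa [opY_apply] using this
  change (leavittRep K n _ (diagFun hn)).1 [] [] = _
  rw [map_mul, Module.End.mul_apply, hX, hY]
  simp [diagFun, eq_comm]

lemma leavittTrace_mul_comm (hn : (n : K) = 1) (a b : LeavittAlgebra K n) :
    leavittTrace hn (a * b) = leavittTrace hn (b * a) := by
  have h := leavittFamily K n
  have ha : a ∈ Algebra.adjoin K (Set.range (lX K n) ∪ Set.range (lY K n)) :=
    adjoin_leavitt K n ▸ Algebra.mem_top
  induction ha using Algebra.adjoin_induction generalizing b with
  | mem a ha =>
    have hb : b ∈ Submodule.span K {z | ∃ I J : List (Fin n),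
        z = (I.map (lX K n)).prod * (J.map (lY K n)).prod} :=
      h.span_monomials (adjoin_leavitt K n) ▸ Submodule.mem_top
    induction hb using Submodule.span_induction with
    | mem b hb =>
      obtain ⟨I, J, rfl⟩ := hb
      rcases ha with ⟨i, rfl⟩ | ⟨i, rfl⟩
      · have e := leavittTrace_monomial hn (i :: I) J
        rw [List.map_cons, List.prod_cons, mul_assoc] at e
        rw [e]
        rcases List.eq_nil_or_concat' J with rfl | ⟨J, j, rfl⟩
        · have e := leavittTrace_monomial hn (I ++ [i]) []
          simpa using e.symm
        · have e₀ := leavittTrace_monomial hn I J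
          rw [List.map_append, List.prod_append, List.map_singleton, List.prod_singleton,
            mul_assoc, mul_assoc, h.mul_eq]
          by_cases hij : j = i
          · subst hij
            simp [e₀]
          · simp [hij, Ne.symm hij]
      · have e := leavittTrace_monomial hn I (J ++ [i])
        rw [List.map_append, List.prod_append, List.map_singleton, List.prod_singleton,
          ← mul_assoc] at e
        rw [e]
        cases I with
        | nil =>
          have e := leavittTrace_monomial hn [] (i :: J)
          simpa using e
        | cons k I =>
          have e₀ := leavittTrace_monomial hn I J
          rw [List.map_cons, List.prod_cons, mul_assoc, ← mul_assoc, h.mul_eq]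
          by_cases hik : i = k
          · subst hik
            simp [e₀]
          · simp [hik, Ne.symm hik]
    | zero => simp
    | add b c _ _ hb hc => rw [mul_add, add_mul, map_add, map_add, hb, hc]
    | smul c b _ hb => rw [mul_smul_comm, smul_mul_assoc, map_smul, map_smul, hb]
  | algebraMap c => rw [Algebra.commutes]
  | add z w _ _ hz hw => rw [mul_add, add_mul, map_add, map_add, hz, hw]
  | mul z w _ _ hz hw => rw [mul_assoc, hz, mul_assoc, hw, mul_assoc]

lemma one_notMem_commSpan (hn : (n : K) = 1) :
    (1 : LeavittAlgebra K n) ∉ commSpan K (LeavittAlgebra K n) := by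
  intro h1
  have hle : commSpan K (LeavittAlgebra K n) ≤ LinearMap.ker (leavittTrace hn) := by
    refine Submodule.span_le.mpr ?_
    rintro _ ⟨a, b, rfl⟩
    simp [leavittTrace_mul_comm hn a b]
  have h : leavittTrace hn 1 = 1 := by simpa using leavittTrace_monomial hn [] []
  exact one_ne_zero (h.symm.trans (hle h1))

end Trace

lemma mem_derivedSeries_one {K A : Type*} [Field K] [Ring A] [Algebra K A] {a : A} :
    a ∈ LieAlgebra.derivedSeries K A 1 ↔ a ∈ commSpan K A := by
  rw [LieAlgebra.derivedSeries_def, LieAlgebra.derivedSeriesOfIdeal_succ,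
    LieAlgebra.derivedSeriesOfIdeal_zero, ← LieSubmodule.mem_toSubmodule,
    LieSubmodule.lieIdeal_oper_eq_linear_span', commSpan]
  simp [LieRing.of_associative_ring_bracket, eq_comm]

/-- Corollary: `[L_K(n)⁻, L_K(n)⁻]` is a simple Lie algebra iff `char K ∣ n - 1`. -/
theorem corollary_d_eq_one (K : Type) [Field K] (n : ℕ) (hn : 2 ≤ n) :
    LieAlgebra.IsSimple K (LieAlgebra.derivedSeries K (LeavittAlgebra K n) 1) ↔
    ((n - 1 : ℕ) : K) = 0 := by
  have h := leavittFamily K n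
  have hcast : ((n - 1 : ℕ) : K) = n - 1 := by rw [Nat.cast_sub (by omega), Nat.cast_one]
  constructor
  · intro hsimple
    by_contra hne
    have hone : (1 : LeavittAlgebra K n) ∈ LieAlgebra.derivedSeries K (LeavittAlgebra K n) 1 := by
      rw [mem_derivedSeries_one]
      exact h.one_mem_commSpan (by rwa [Fintype.card_fin, ← hcast])
    have hcenter : (⟨1, hone⟩ : LieAlgebra.derivedSeries K (LeavittAlgebra K n) 1) ∈
        LieAlgebra.center K (LieAlgebra.derivedSeries K (LeavittAlgebra K n) 1) := by
      rw [LieModule.mem_maxTrivSubmodule]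
      intro z
      apply Subtype.ext
      change ⁅(z : LeavittAlgebra K n), (1 : LeavittAlgebra K n)⁆ = 0
      simp [LieRing.of_associative_ring_bracket]
    rw [LieAlgebra.center_eq_bot, LieSubmodule.mem_bot] at hcenter
    have h10 : (1 : LeavittAlgebra K n) = 0 := congrArg Subtype.val hcenter
    refine hsimple.non_abelian ⟨fun a b => ?_⟩
    apply Subtype.ext
    rw [← mul_one (Subtype.val _), h10, mul_zero]
    rfl
  · intro hzero
    have hn1 : (n : K) = 1 := by rw [hcast] at hzero; exact sub_eq_zero.mp hzero
    have hn3 : 3 ≤ n := by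
      rcases hn.eq_or_lt with rfl | hlt
      · simp at hzero
      · exact hlt
    have h1 := one_notMem_commSpan hn1
    have : Nontrivial (Fin n) := Fin.nontrivial_iff_two_le.mpr hn
    refine ⟨fun I => ?_, fun habel => ?_⟩
    · have hcard : 5 ≤ Fintype.card (Fin n × Fin n) := by
        rw [Fintype.card_prod, Fintype.card_fin]
        nlinarith
      let U : Submodule K (LeavittAlgebra K n) := I.toSubmodule.map
        (LieAlgebra.derivedSeries K (LeavittAlgebra K n) 1).toSubmodule.subtype
      have hW : U ≤ commSpan K (LeavittAlgebra K n) := by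
        rintro _ ⟨z, -, rfl⟩
        exact mem_derivedSeries_one.mp z.2
      have hU : ∀ u ∈ U, ∀ w ∈ commSpan K (LeavittAlgebra K n), u * w - w * u ∈ U := by
        rintro _ ⟨z, hz, rfl⟩ w hw
        exact ⟨_, lie_mem_left K _ I z ⟨w, mem_derivedSeries_one.mpr hw⟩ hz, rfl⟩
      rcases h.prod.lieIdeal_eq_bot_or_commSpan_le hcard
        (fun a ha => h.exists_mul_eq_one (adjoin_leavitt K n) ha) h1 hW hU with hbot | htop
      · left
        rw [eq_bot_iff]
        intro z hz
        have : (z : LeavittAlgebra K n) ∈ U := ⟨z, hz, rfl⟩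
        rw [hbot, Submodule.mem_bot] at this
        exact Subtype.ext this
      · right
        rw [eq_top_iff]
        rintro z -
        obtain ⟨w, hw, hwz⟩ := htop (mem_derivedSeries_one.mp z.2)
        rwa [← Subtype.ext hwz]
    · obtain ⟨p, q, hpq⟩ := exists_pair_ne (Fin n)
      have m1 := mem_derivedSeries_one.mpr (h.unit_mem_commSpan K hpq 1)
      have m2 := mem_derivedSeries_one.mpr (h.unit_mem_commSpan K hpq.symm 1)
      have e := congrArg Subtype.val (habel.trivial ⟨_, m1⟩ ⟨_, m2⟩)
      refine h1 ?_
      rw [h.one_eq_zero_of_comm_eq_zero hpq e]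
      exact Submodule.zero_mem _
end
end

section
/- Let K be a field and n ≥ 2 an integer. The family { x_I y_J : I, J words in the alphabet {1,…,n} }, indexed by pairs of words (I,J), is a K-vector space basis of the Cohn algebra C_K(n); that is, there is a basis b of C_K(n) over K, indexed by pairs of words, with b(I,J) = x_I y_J for all I, J. -/
noncomputable section

open scoped BigOperators

namespace CohnAlgebra

variable (K : Type) [Field K] (n : ℕ)

theorem cY_mul_cX (i j : Fin n) : cY K n i * cX K n j = if i = j then 1 else 0 := by
  rw [cX, cY, ← map_mul, RingQuot.mkAlgHom_rel K (CohnRel.rel i j)]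
  split_ifs <;> simp

/-- The vector space on which the Cohn algebra is represented: its basis vectors are the normal
forms `(I, J)`, standing for `x_I y_J`. -/
abbrev NormalForms := (List (Fin n) × List (Fin n)) →₀ K

/-- Left multiplication by `x_i` on a normal form. -/
def xAct (i : Fin n) : Module.End K (NormalForms K n) :=
  Finsupp.linearCombination K fun p => Finsupp.single (i :: p.1, p.2) 1

/-- Left multiplication by `y_i` on a normal form. -/
def yAct (i : Fin n) : Module.End K (NormalForms K n) :=
  Finsupp.linearCombination K fun p =>
    match p with
    | ([], J) => Finsupp.single ([], i :: J) 1
    | (j :: I, J) => if i = j then Finsupp.single (I, J) 1 else 0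

variable {K n}

@[simp]
theorem xAct_single (i : Fin n) (I J : List (Fin n)) :
    xAct K n i (Finsupp.single (I, J) 1) = Finsupp.single (i :: I, J) 1 := by
  simp [xAct]

@[simp]
theorem yAct_single_nil (i : Fin n) (J : List (Fin n)) :
    yAct K n i (Finsupp.single ([], J) 1) = Finsupp.single ([], i :: J) 1 := by
  simp [yAct]

@[simp]
theorem yAct_single_cons (i j : Fin n) (I J : List (Fin n)) :
    yAct K n i (Finsupp.single (j :: I, J) 1) =
      if i = j then Finsupp.single (I, J) 1 else 0 := by
  simp [yAct]

theorem yAct_mul_xAct (i j : Fin n) :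
    yAct K n i * xAct K n j = if i = j then 1 else 0 := by
  refine Finsupp.lhom_ext' fun p => LinearMap.ext_ring ?_
  obtain ⟨I, J⟩ := p
  split_ifs with h <;> simp [h]

variable (K n)

/-- The representation of the Cohn algebra by left multiplication on normal forms. -/
def leftRep : CohnAlgebra K n →ₐ[K] Module.End K (NormalForms K n) :=
  RingQuot.liftAlgHom K ⟨FreeAlgebra.lift K (Sum.elim (xAct K n) (yAct K n)), by
    rintro _ _ ⟨i, j⟩
    have h := yAct_mul_xAct (K := K) i j
    split_ifs at h ⊢ <;> simpa using h⟩

@[simp]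
theorem leftRep_cX (i : Fin n) : leftRep K n (cX K n i) = xAct K n i := by
  simp [leftRep, cX]

@[simp]
theorem leftRep_cY (i : Fin n) : leftRep K n (cY K n i) = yAct K n i := by
  simp [leftRep, cY]

/-- The linear map sending the normal form `(I, J)` to the element `x_I y_J`. -/
def ofNormalForms : NormalForms K n →ₗ[K] CohnAlgebra K n :=
  Finsupp.linearCombination K fun p => xw K n p.1 * yw K n p.2

/-- The normal form of an element of the Cohn algebra. -/
def toNormalForms : CohnAlgebra K n →ₗ[K] NormalForms K n :=
  (LinearMap.applyₗ (Finsupp.single ([], []) 1)).comp (leftRep K n).toLinearMap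

variable {K n}

@[simp]
theorem ofNormalForms_single (I J : List (Fin n)) :
    ofNormalForms K n (Finsupp.single (I, J) 1) = xw K n I * yw K n J := by
  simp [ofNormalForms]

theorem ofNormalForms_xAct (i : Fin n) (v : NormalForms K n) :
    ofNormalForms K n (xAct K n i v) = cX K n i * ofNormalForms K n v := by
  suffices h : (ofNormalForms K n).comp (xAct K n i) =
      (LinearMap.mulLeft K (cX K n i)).comp (ofNormalForms K n) from LinearMap.congr_fun h v
  refine Finsupp.lhom_ext' fun p => LinearMap.ext_ring ?_
  obtain ⟨I, J⟩ := p
  simp [xw, mul_assoc]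

theorem ofNormalForms_yAct (i : Fin n) (v : NormalForms K n) :
    ofNormalForms K n (yAct K n i v) = cY K n i * ofNormalForms K n v := by
  suffices h : (ofNormalForms K n).comp (yAct K n i) =
      (LinearMap.mulLeft K (cY K n i)).comp (ofNormalForms K n) from LinearMap.congr_fun h v
  refine Finsupp.lhom_ext' fun p => LinearMap.ext_ring ?_
  obtain ⟨_ | ⟨j, I⟩, J⟩ := p
  · simp [xw, yw]
  · have hx : xw K n (j :: I) = cX K n j * xw K n I := by simp [xw]
    simp only [LinearMap.comp_apply, Finsupp.lsingle_apply, yAct_single_cons,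
      ofNormalForms_single, LinearMap.mulLeft_apply, hx, ← mul_assoc, cY_mul_cX]
    split_ifs <;> simp

theorem ofNormalForms_leftRep (a : CohnAlgebra K n) (v : NormalForms K n) :
    ofNormalForms K n (leftRep K n a v) = a * ofNormalForms K n v := by
  obtain ⟨a, rfl⟩ := RingQuot.mkAlgHom_surjective K (CohnRel K n) a
  induction a using FreeAlgebra.induction generalizing v with
  | grade0 r => simp [Algebra.algebraMap_eq_smul_one]
  | grade1 s =>
    rcases s with i | i
    · rw [← cX, leftRep_cX, ofNormalForms_xAct]
    · rw [← cY, leftRep_cY, ofNormalForms_yAct]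
  | mul a b ha hb => rw [map_mul, map_mul, Module.End.mul_apply, ha, hb, mul_assoc]
  | add a b ha hb => rw [map_add, map_add, LinearMap.add_apply, map_add, ha, hb, add_mul]

theorem leftRep_yw (J : List (Fin n)) :
    leftRep K n (yw K n J) (Finsupp.single ([], []) 1) = Finsupp.single ([], J) 1 := by
  induction J with
  | nil => simp [yw]
  | cons j J ih =>
    have hy : yw K n (j :: J) = cY K n j * yw K n J := by simp [yw]
    rw [hy, map_mul, Module.End.mul_apply, ih, leftRep_cY, yAct_single_nil]

theorem leftRep_xw (I J : List (Fin n)) :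
    leftRep K n (xw K n I) (Finsupp.single ([], J) 1) = Finsupp.single (I, J) 1 := by
  induction I with
  | nil => simp [xw]
  | cons i I ih =>
    have hx : xw K n (i :: I) = cX K n i * xw K n I := by simp [xw]
    rw [hx, map_mul, Module.End.mul_apply, ih, leftRep_cX, xAct_single]

variable (K n)

/-- The Cohn algebra is linearly isomorphic to the space of normal forms. -/
def normalFormsEquiv : CohnAlgebra K n ≃ₗ[K] NormalForms K n :=
  LinearEquiv.ofLinearMap (toNormalForms K n) (ofNormalForms K n)
    (by
      refine Finsupp.lhom_ext' fun p => LinearMap.ext_ring ?_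
      obtain ⟨I, J⟩ := p
      simp [toNormalForms, leftRep_yw, leftRep_xw])
    (by
      ext a
      simp [toNormalForms, ofNormalForms_leftRep, xw, yw])

end CohnAlgebra

/-- Lemma 1.2(i): the family `x_I y_J`, indexed by pairs of words `(I, J)`, is a
`K`-vector space basis of the Cohn algebra `C_K(n)`. -/
theorem cohn_basis (K : Type) [Field K] (n : ℕ) (hn : 2 ≤ n) :
    ∃ b : Module.Basis (List (Fin n) × List (Fin n)) K (CohnAlgebra K n),
      ∀ I J : List (Fin n), b (I, J) = xw K n I * yw K n J := by
  exact ⟨.ofRepr (CohnAlgebra.normalFormsEquiv K n),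
    fun I J => CohnAlgebra.ofNormalForms_single I J⟩
end
end

section
/- Let K be a field and let n ≥ 2, d ≥ 1 be integers. If char(K) does not divide n−1 (i.e. (n−1)·1_K ≠ 0 in K), then 1_{M_d(L_K(n))} ∈ [M_d(L_K(n))⁻, M_d(L_K(n))⁻]; that is, the identity matrix is a finite sum of commutators AB − BA with A, B ∈ M_d(L_K(n)). -/
noncomputable section

open scoped BigOperators

attribute [local instance 100] LieRing.ofAssociativeRing

/-- If a `K`-algebra contains families `x`, `y` indexed by `Fin n` with `y i * x i = 1` and
`∑ i, x i * y i = 1`, then `(n - 1) • 1 = ∑ i, ⁅y i, x i⁆`; hence `1` lies in the derived Lie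
subalgebra as soon as `n - 1` is nonzero in `K`. -/
theorem one_mem_derivedSeries_one_of_leavitt_family {K A : Type*} [Field K] [Ring A] [Algebra K A]
    {n : ℕ} (hn : 1 ≤ n) (hchar : ((n - 1 : ℕ) : K) ≠ 0) (x y : Fin n → A)
    (hyx : ∀ i, y i * x i = 1) (hxy : ∑ i, x i * y i = 1) :
    (1 : A) ∈ LieAlgebra.derivedSeries K A 1 := by
  have hmem : ∑ i, ⁅y i, x i⁆ ∈ LieAlgebra.derivedSeries K A 1 :=
    sum_mem fun i _ => LieSubmodule.lie_mem_lie (LieSubmodule.mem_top _) (LieSubmodule.mem_top _)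
  have hsum : ∑ i, ⁅y i, x i⁆ = ((n - 1 : ℕ) : K) • (1 : A) := by
    simp [Ring.lie_def, Finset.sum_sub_distrib, hyx, hxy, Nat.cast_sub hn, sub_smul,
      Nat.cast_smul_eq_nsmul]
  have hone := (LieAlgebra.derivedSeries K A 1).smul_mem ((n - 1 : ℕ) : K)⁻¹ hmem
  rwa [hsum, inv_smul_smul₀ hchar] at hone

theorem cY_mul_cX_self (K : Type) [Field K] (n : ℕ) (i : Fin n) : cY K n i * cX K n i = 1 := by
  have h := RingQuot.mkAlgHom_rel K (CohnRel.rel (K := K) i i)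
  rwa [map_mul, if_pos rfl, map_one] at h

theorem sum_leavittQuot_cX_mul_cY (K : Type) [Field K] (n : ℕ) :
    ∑ i, leavittQuot K n (cX K n i) * leavittQuot K n (cY K n i) = 1 := by
  have h := RingQuot.mkAlgHom_rel K (LeavittRel.rel (K := K) (n := n))
  simpa only [leavittQuot, map_sum, map_mul, map_one] using h

/-- Case 1 of the proof of Theorem 3.8: if `char K ∤ n - 1` then the identity
matrix belongs to `[M_d(L_K(n))⁻, M_d(L_K(n))⁻]`. -/
theorem one_mem_commutator_of_char_not_dvd (K : Type) [Field K] (n d : ℕ)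
    (hn : 2 ≤ n) (hd : 1 ≤ d) (hchar : ((n - 1 : ℕ) : K) ≠ 0) :
    (1 : Matrix (Fin d) (Fin d) (LeavittAlgebra K n)) ∈
      LieAlgebra.derivedSeries K (Matrix (Fin d) (Fin d) (LeavittAlgebra K n)) 1 := by
  refine one_mem_derivedSeries_one_of_leavitt_family (by lia) hchar
    (fun i => Matrix.scalar (Fin d) (leavittQuot K n (cX K n i)))
    (fun i => Matrix.scalar (Fin d) (leavittQuot K n (cY K n i))) (fun i => ?_) ?_
  · rw [← map_mul, ← map_mul, cY_mul_cX_self, map_one, map_one]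
  · simp only [← map_mul (Matrix.scalar (Fin d)), ← map_sum (Matrix.scalar (Fin d)),
      sum_leavittQuot_cX_mul_cY, map_one]
end
end

section
/- Let K be a field and let n ≥ 2, d ≥ 1 be integers. If char(K) divides d (i.e. d·1_K = 0 in K), then 1_{M_d(L_K(n))} ∈ [M_d(L_K(n))⁻, M_d(L_K(n))⁻]; that is, the identity matrix is a finite sum of commutators AB − BA with A, B ∈ M_d(L_K(n)). -/
noncomputable section

open scoped BigOperators

attribute [local instance 100] LieRing.ofAssociativeRing

/-- Over a `K`-algebra `A` with `d = 0` in `K`, the identity matrix of size `d` is the sum of the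
commutators `[E_{i0}, E_{0i}] = E_{ii} - E_{00}`. -/
theorem one_mem_derivedSeries_matrix {K A : Type*} [Field K] [Ring A] [Algebra K A] (d : ℕ)
    (hd : 1 ≤ d) (hchar : (d : K) = 0) :
    (1 : Matrix (Fin d) (Fin d) A) ∈
      LieAlgebra.derivedSeries K (Matrix (Fin d) (Fin d) A) 1 := by
  let o : Fin d := ⟨0, hd⟩
  have hdA : (d : A) = 0 := by
    rw [← map_natCast (algebraMap K A), hchar, map_zero]
  have hsum : (1 : Matrix (Fin d) (Fin d) A) =
      ∑ i : Fin d, ⁅Matrix.single i o (1 : A), Matrix.single o i (1 : A)⁆ := by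
    simp only [Ring.lie_def, Matrix.single_mul_single_same, mul_one, Finset.sum_sub_distrib,
      Finset.sum_const, Finset.card_univ, Fintype.card_fin, Matrix.sum_single_one]
    simp [Matrix.smul_single, hdA]
  rw [hsum]
  refine sum_mem fun i _ => ?_
  rw [LieAlgebra.derivedSeries_def, LieAlgebra.derivedSeriesOfIdeal_succ]
  exact LieSubmodule.lie_mem_lie (LieSubmodule.mem_top _) (LieSubmodule.mem_top _)

/-- Case 2 of the proof of Theorem 3.8: if `char K ∣ d` then the identity
matrix belongs to `[M_d(L_K(n))⁻, M_d(L_K(n))⁻]`. -/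
theorem one_mem_commutator_of_char_dvd_d (K : Type) [Field K] (n d : ℕ)
    (hn : 2 ≤ n) (hd : 1 ≤ d) (hchar : (d : K) = 0) :
    (1 : Matrix (Fin d) (Fin d) (LeavittAlgebra K n)) ∈
      LieAlgebra.derivedSeries K (Matrix (Fin d) (Fin d) (LeavittAlgebra K n)) 1 := by
  exact one_mem_derivedSeries_matrix d hd hchar
end
end
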